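/- Let u be a stable regular solution of −Δ_p u = f(u) in the unit ball B₁ ⊂ ℝⁿ, with f ∈ C¹(ℝ), and let φ be a Lipschitz function on B₁. Then there is a constant C, depending only on n and p, such that for every ρ ∈ (0, 2/3): ∫_{B_ρ} 2|∇u|^p r φ_r φ dx − p ∫_{B_ρ} r u_r |∇u|^{p−2} ∇u·∇(φ²) dx + (n−p) ∫_{B_ρ} |∇u|^p φ² dx − ∫_{B_ρ} r² u_r² |∇u|^{p−2} |∇φ|² dx − (p−2) ∫_{B_ρ} r² u_r² |∇u|^{p−4} (∇u·∇φ)² dx ≤ C ∫_{B_{3ρ/2} \ B_ρ} |∇u|^p ( φ² + r|φ| |∇φ| + r² |∇φ|² ) dx, where ∇φ denotes the almost-everywhere defined gradient of φ and φ_r = (x/|x|)·∇φ. -/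

import Mathlib

open MeasureTheory Metric Set Filter
open scoped RealInnerProductSpace

noncomputable section

abbrev Euc (n : ℕ) := EuclideanSpace ℝ (Fin n)

/-- `u` is a regular solution of `−Δ_p u = f(u)` in the open set `U ⊆ ℝⁿ`:
`u ∈ C¹(U)`, `f ∘ u ∈ L^∞(U)`, and the equation holds in the weak sense against
all `C¹` test functions with compact support in `U`. -/
def IsRegularSolution (n : ℕ) (p : ℝ) (U : Set (Euc n)) (f : ℝ → ℝ) (u : Euc n → ℝ) : Prop :=
  ContDiffOn ℝ 1 u U ∧
  (∃ C : ℝ, ∀ x ∈ U, |f (u x)| ≤ C) ∧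
  ∀ ξ : Euc n → ℝ, ContDiff ℝ 1 ξ → HasCompactSupport ξ → tsupport ξ ⊆ U →
    ∫ x in U, ‖gradient u x‖ ^ (p - 2) * ⟪gradient u x, gradient ξ x⟫
      = ∫ x in U, f (u x) * ξ x

/-- `u` is a stable regular solution of `−Δ_p u = f(u)` in `U`: the second variation of the
energy is nonnegative on all Lipschitz test functions with compact support in `U`. -/
def IsStableRegularSolution (n : ℕ) (p : ℝ) (U : Set (Euc n)) (f : ℝ → ℝ)
    (u : Euc n → ℝ) : Prop :=
  IsRegularSolution n p U f u ∧
  ∀ ξ : Euc n → ℝ, (∃ K, LipschitzWith K ξ) → HasCompactSupport ξ → tsupport ξ ⊆ U →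
    0 ≤ (∫ x in U ∩ {y | 0 < ‖gradient u y‖},
          (‖gradient u x‖ ^ (p - 2) * ‖gradient ξ x‖ ^ 2
            + (p - 2) * ‖gradient u x‖ ^ (p - 4) * ⟪gradient u x, gradient ξ x⟫ ^ 2))
        - ∫ x in U, deriv f (u x) * ξ x ^ 2

/-- The radial derivative `u_r(x) = (x/|x|)·∇u(x)` (junk value `0` at `x = 0`). -/
def radialDeriv {n : ℕ} (u : Euc n → ℝ) (x : Euc n) : ℝ := ⟪x, gradient u x⟫ / ‖x‖

/-- The dimension condition (★): `n < p + 4p/(p−1)` if `p ≥ 2`, and `n < 5p` if `1 < p < 2`. -/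
def DimensionCondition (n : ℕ) (p : ℝ) : Prop :=
  (2 ≤ p → (n : ℝ) < p + 4 * p / (p - 1)) ∧ (p < 2 → (n : ℝ) < 5 * p)

section VectorInequalities

variable {E : Type*} [NormedAddCommGroup E] [InnerProductSpace ℝ E]

/-- The flux `a ↦ |a|^{p-2} a` of the `p`-Laplacian. -/
def pFlux (p : ℝ) (a : E) : E := ‖a‖ ^ (p - 2) • a

/-- The derivative of the flux `pFlux p` at `a`, as a bilinear form. -/
def pHess (p : ℝ) (a y z : E) : ℝ :=
  ‖a‖ ^ (p - 2) * ⟪y, z⟫ + (p - 2) * ‖a‖ ^ (p - 4) * (⟪a, y⟫ * ⟪a, z⟫)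

lemma rpow_sub_two_mul_sq {p t : ℝ} (hp : 1 < p) (ht : 0 ≤ t) : t ^ (p - 2) * t ^ 2 = t ^ p := by
  rcases ht.eq_or_lt with rfl | ht
  · simp [Real.zero_rpow (zero_lt_one.trans hp).ne']
  · rw [← Real.rpow_natCast t 2, ← Real.rpow_add ht]; norm_num

lemma rpow_sub_two_mul_self {p t : ℝ} (hp : 1 < p) (ht : 0 ≤ t) :
    t ^ (p - 2) * t = t ^ (p - 1) := by
  rcases ht.eq_or_lt with rfl | ht
  · simp [Real.zero_rpow (sub_pos.2 hp).ne']
  · rw [← Real.rpow_add_one ht.ne']; ring_nf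

lemma norm_pFlux {p : ℝ} (hp : 1 < p) (a : E) : ‖pFlux p a‖ = ‖a‖ ^ (p - 1) := by
  rw [pFlux, norm_smul, Real.norm_of_nonneg (by positivity),
    rpow_sub_two_mul_self hp (norm_nonneg _)]

lemma pFlux_smul {p t : ℝ} (hp : 1 < p) (ht : 0 ≤ t) (a : E) :
    pFlux p (t • a) = t ^ (p - 1) • pFlux p a := by
  rw [pFlux, pFlux, norm_smul, Real.norm_of_nonneg ht, Real.mul_rpow ht (norm_nonneg _), smul_smul,
    smul_smul, ← rpow_sub_two_mul_self hp ht]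
  ring_nf

/-- Convexity of `a ↦ |a|^p / p`. -/
lemma inner_pFlux_sub_le {p : ℝ} (hp : 1 < p) (a b : E) :
    ⟪pFlux p a, b - a⟫ ≤ (‖b‖ ^ p - ‖a‖ ^ p) / p := by
  have hconj : p.HolderConjugate (p / (p - 1)) := Real.HolderConjugate.conjExponent hp
  have hY := Real.young_inequality_of_nonneg (norm_nonneg b)
    (Real.rpow_nonneg (norm_nonneg a) (p - 1)) hconj
  rw [← Real.rpow_mul (norm_nonneg a), mul_div_cancel₀ _ (by linarith : p - 1 ≠ 0)] at hY
  have h1 : ⟪pFlux p a, b⟫ ≤ ‖a‖ ^ (p - 1) * ‖b‖ := by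
    rw [← norm_pFlux hp]; exact real_inner_le_norm _ _
  have h2 : ⟪pFlux p a, a⟫ = ‖a‖ ^ p := by
    rw [pFlux, real_inner_smul_left, real_inner_self_eq_norm_sq,
      rpow_sub_two_mul_sq hp (norm_nonneg _)]
  rw [inner_sub_right, h2]
  have h3 : ‖a‖ ^ p / (p / (p - 1)) = ‖a‖ ^ p - ‖a‖ ^ p / p := by
    field_simp
  rw [h3] at hY
  rw [sub_div]
  linarith

lemma rpow_sub_four_mul_sq_le {p : ℝ} (a z : E) :
    ‖a‖ ^ (p - 4) * ⟪a, z⟫ ^ 2 ≤ ‖a‖ ^ (p - 2) * ‖z‖ ^ 2 := by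
  rcases eq_or_ne a 0 with rfl | ha
  · simp; positivity
  · have ha' : 0 < ‖a‖ := norm_pos_iff.2 ha
    have h1 : ‖a‖ ^ (p - 2) = ‖a‖ ^ (p - 4) * ‖a‖ ^ 2 := by
      rw [← Real.rpow_natCast ‖a‖ 2, ← Real.rpow_add ha']; norm_num; ring_nf
    have h2 : ⟪a, z⟫ ^ 2 ≤ (‖a‖ * ‖z‖) ^ 2 := by
      rw [← sq_abs]; gcongr; exact abs_real_inner_le_norm _ _
    rw [h1, mul_assoc, ← mul_pow]; gcongr

lemma abs_pHess_self_le (p : ℝ) (a z : E) :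
    |pHess p a z z| ≤ (1 + |p - 2|) * (‖a‖ ^ (p - 2) * ‖z‖ ^ 2) := by
  have h := rpow_sub_four_mul_sq_le (p := p) a z
  have h0 : 0 ≤ ‖a‖ ^ (p - 4) * ⟪a, z⟫ ^ 2 := by positivity
  have h1 : 0 ≤ ‖a‖ ^ (p - 2) * ‖z‖ ^ 2 := by positivity
  have : pHess p a z z = ‖a‖ ^ (p - 2) * ‖z‖ ^ 2 + (p - 2) * (‖a‖ ^ (p - 4) * ⟪a, z⟫ ^ 2) := by
    rw [pHess, real_inner_self_eq_norm_sq]; ring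
  rw [this]
  refine (abs_add_le _ _).trans ?_
  rw [abs_mul (p - 2), abs_of_nonneg h0, abs_of_nonneg h1, add_mul, one_mul]
  gcongr

lemma le_pHess_self (p : ℝ) (a z : E) :
    min 1 (p - 1) * (‖a‖ ^ (p - 2) * ‖z‖ ^ 2) ≤ pHess p a z z := by
  have h := rpow_sub_four_mul_sq_le (p := p) a z
  have h0 : 0 ≤ ‖a‖ ^ (p - 4) * ⟪a, z⟫ ^ 2 := by positivity
  have h1 : 0 ≤ ‖a‖ ^ (p - 2) * ‖z‖ ^ 2 := by positivity
  have : pHess p a z z = ‖a‖ ^ (p - 2) * ‖z‖ ^ 2 + (p - 2) * (‖a‖ ^ (p - 4) * ⟪a, z⟫ ^ 2) := by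
    rw [pHess, real_inner_self_eq_norm_sq]; ring
  rw [this]
  rcases le_total 2 p with h2 | h2
  · rw [min_eq_left (by linarith)]; nlinarith
  · rw [min_eq_right (by linarith)]; nlinarith

omit [InnerProductSpace ℝ E] in
lemma continuousOn_rpow_norm (q : ℝ) : ContinuousOn (fun a : E => ‖a‖ ^ q) {0}ᶜ :=
  continuous_norm.continuousOn.rpow_const fun _ ha => Or.inl (norm_ne_zero_iff.2 ha)

/-- The derivative of the flux, as a continuous linear map. -/
def pFluxDeriv (p : ℝ) (a : E) : E →L[ℝ] E :=
  ‖a‖ ^ (p - 2) • ContinuousLinearMap.id ℝ E +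
    ((p - 2) * ‖a‖ ^ (p - 4)) • (innerSL ℝ a).smulRight a

lemma inner_pFluxDeriv (p : ℝ) (a y z : E) : ⟪pFluxDeriv p a y, z⟫ = pHess p a y z := by
  simp [pFluxDeriv, pHess, inner_add_left, real_inner_smul_left]

lemma hasFDerivAt_pFlux (p : ℝ) {a : E} (ha : a ≠ 0) :
    HasFDerivAt (pFlux p) (pFluxDeriv p a) a := by
  have ha' : 0 < ‖a‖ := norm_pos_iff.2 ha
  have h1 : HasFDerivAt (fun x : E => (‖x‖ ^ 2) ^ ((p - 2) / 2))
      ((((p - 2) / 2) * (‖a‖ ^ 2) ^ ((p - 2) / 2 - 1)) • (2 • innerSL ℝ a)) a :=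
    (hasStrictFDerivAt_norm_sq a).hasFDerivAt.rpow_const (Or.inl (by positivity))
  have key : ∀ (x : E) (q : ℝ), (‖x‖ ^ 2) ^ (q / 2) = ‖x‖ ^ q := fun x q => by
    rw [← Real.rpow_natCast, ← Real.rpow_mul (norm_nonneg _)]; congr 1; push_cast; ring
  rw [show (p - 2) / 2 - 1 = (p - 4) / 2 by ring, key] at h1
  simp only [key] at h1
  refine (h1.smul (hasFDerivAt_id a)).congr_fderiv ?_
  ext z
  simp only [pFluxDeriv, add_apply, smul_apply,
    ContinuousLinearMap.smulRight_apply, smul_smul, id]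
  congr 2
  simp only [innerSL_apply_apply, smul_eq_mul, nsmul_eq_mul]
  push_cast
  ring

lemma continuousOn_pFluxDeriv (p : ℝ) :
    ContinuousOn (pFluxDeriv p : E → E →L[ℝ] E) {0}ᶜ := by
  have h3 : Continuous fun a : E => (innerSL ℝ a).smulRight a :=
    isBoundedBilinearMap_smulRight.continuous.comp
      ((innerSL ℝ (E := E)).continuous.prodMk continuous_id)
  exact ((continuousOn_rpow_norm _).smul continuousOn_const).add
    ((continuousOn_const.mul (continuousOn_rpow_norm _)).smul h3.continuousOn)

/-- Uniform first order expansion of the flux away from the origin. -/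
lemma exists_pFlux_expansion [FiniteDimensional ℝ E] (p : ℝ) {m M ε : ℝ} (hm : 0 < m)
    (hε : 0 < ε) :
    ∃ γ > 0, ∀ a b : E, m ≤ ‖a‖ → ‖a‖ ≤ M → ‖b - a‖ ≤ γ →
      ‖pFlux p b - pFlux p a - pFluxDeriv p a (b - a)‖ ≤ ε * ‖b - a‖ := by
  set K : Set E := closedBall 0 (M + m) \ ball 0 (m / 2) with hK
  have hKc : IsCompact K := (isCompact_closedBall _ _).diff isOpen_ball
  have hK0 : K ⊆ {0}ᶜ := fun x hx => by
    rintro rfl; exact hx.2 (mem_ball_self (by positivity))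
  have huc := hKc.uniformContinuousOn_of_continuous ((continuousOn_pFluxDeriv p).mono hK0)
  obtain ⟨γ, hγ, H⟩ := Metric.uniformContinuousOn_iff.1 huc ε hε
  refine ⟨min (γ / 2) (m / 2), by positivity, fun a b ha hM hb => ?_⟩
  have hball : closedBall a (min (γ / 2) (m / 2)) ⊆ K := fun x hx => by
    have h1 : ‖x - a‖ ≤ m / 2 := (mem_closedBall_iff_norm.1 hx).trans (min_le_right _ _)
    have h2 := norm_sub_norm_le x a
    have h3 := norm_sub_norm_le a x
    rw [norm_sub_rev] at h3
    refine ⟨mem_closedBall_zero_iff.2 (by linarith), fun h => ?_⟩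
    rw [mem_ball_zero_iff] at h; linarith
  have h0 : 0 ≤ min (γ / 2) (m / 2) := by positivity
  refine Convex.norm_image_sub_le_of_norm_hasFDerivWithin_le'
    (fun x hx => (hasFDerivAt_pFlux p (hK0 (hball hx))).hasFDerivWithinAt) (fun x hx => ?_)
    (convex_closedBall a (min (γ / 2) (m / 2))) (mem_closedBall_self h0)
    (mem_closedBall_iff_norm.2 hb)
  rw [← dist_eq_norm]
  refine (H x (hball hx) a (hball (mem_closedBall_self h0)) ?_).le
  calc dist x a ≤ γ / 2 := (mem_closedBall.1 hx).trans (min_le_left _ _)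
    _ < γ := by linarith

end VectorInequalities
section GradientCalculus

variable {E : Type*} [NormedAddCommGroup E] [InnerProductSpace ℝ E] [CompleteSpace E]

lemma gradient_mul {f g : E → ℝ} {x : E} (hf : DifferentiableAt ℝ f x)
    (hg : DifferentiableAt ℝ g x) :
    gradient (fun y => f y * g y) x = f x • gradient g x + g x • gradient f x := by
  refine HasGradientAt.gradient (hasGradientAt_iff_hasFDerivAt.2 ?_)
  refine (hf.hasFDerivAt.mul hg.hasFDerivAt).congr_fderiv ?_
  simp [toDual_gradient]

lemma norm_gradient (f : E → ℝ) (x : E) : ‖gradient f x‖ = ‖fderiv ℝ f x‖ := by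
  simp [gradient]

lemma norm_gradient_le {f : E → ℝ} {K : NNReal} (hf : LipschitzWith K f) (x : E) :
    ‖gradient f x‖ ≤ K := by
  rw [norm_gradient]; exact norm_fderiv_le_of_lipschitz ℝ hf

lemma measurable_gradient [MeasurableSpace E] [BorelSpace E] (f : E → ℝ) :
    Measurable (gradient f) :=
  (InnerProductSpace.toDual ℝ E).symm.continuous.measurable.comp (measurable_fderiv ℝ f)

lemma continuous_gradient {f : E → ℝ} (hf : ContDiff ℝ 1 f) : Continuous (gradient f) :=
  (InnerProductSpace.toDual ℝ E).symm.continuous.comp (hf.continuous_fderiv one_ne_zero)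

lemma gradient_eq_zero_of_notMem_tsupport {f : E → ℝ} {x : E} (hx : x ∉ tsupport f) :
    gradient f x = 0 := by
  rw [(notMem_tsupport_iff_eventuallyEq.1 hx).gradient_eq]
  exact gradient_const x 0

/-- The dilation difference quotient of `v`. -/
def dilQuot (v : E → ℝ) (l : ℝ) (x : E) : ℝ := (l - 1)⁻¹ * (v (l • x) - v x)

lemma hasGradientAt_dilQuot {v : E → ℝ} (hv : Differentiable ℝ v) (l : ℝ) (x : E) :
    HasGradientAt (dilQuot v l) ((l - 1)⁻¹ • (l • gradient v (l • x) - gradient v x)) x := by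
  rw [hasGradientAt_iff_hasFDerivAt]
  have h1 : HasFDerivAt (fun y : E => l • y) (l • ContinuousLinearMap.id ℝ E) x :=
    (hasFDerivAt_id x).const_smul l
  have h2 := ((hv (l • x)).hasFDerivAt.comp x h1).sub (hv x).hasFDerivAt
  refine (h2.const_mul (l - 1)⁻¹).congr_fderiv ?_
  simp [toDual_gradient]

lemma hasDerivAt_comp_smul {v : E → ℝ} (hv : Differentiable ℝ v) (x : E) (l : ℝ) :
    HasDerivAt (fun l : ℝ => v (l • x)) ⟪x, gradient v (l • x)⟫ l := by
  have h1 : HasDerivAt (fun l : ℝ => l • x) x l := by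
    simpa using (hasDerivAt_id l).smul_const x
  have := (hv (l • x)).hasFDerivAt.comp_hasDerivAt l h1
  rw [inner_gradient_right]
  exact this

lemma tendsto_dilQuot {v : E → ℝ} (hv : Differentiable ℝ v) (x : E) :
    Tendsto (fun l => dilQuot v l x) (nhdsWithin 1 {1}ᶜ) (nhds ⟪x, gradient v x⟫) := by
  have := (hasDerivAt_comp_smul hv x 1).tendsto_slope
  simpa [slope_fun_def, dilQuot] using this

omit [CompleteSpace E] in
lemma abs_dilQuot_le {v : E → ℝ} {K : NNReal} (hv : LipschitzWith K v) (l : ℝ) (x : E) :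
    |dilQuot v l x| ≤ K * ‖x‖ := by
  rcases eq_or_ne l 1 with rfl | hl
  · simp [dilQuot]; positivity
  have h := hv.dist_le_mul (l • x) x
  rw [Real.dist_eq, dist_eq_norm, show l • x - x = (l - 1) • x by rw [sub_smul, one_smul],
    norm_smul, Real.norm_eq_abs] at h
  have hl' : 0 < |l - 1| := abs_pos.2 (sub_ne_zero.2 hl)
  rw [dilQuot, abs_mul, abs_inv, inv_mul_le_iff₀ hl']
  linarith

omit [CompleteSpace E] in
lemma exists_lipschitzWith_dilQuot {v : E → ℝ} {K : NNReal} (hv : LipschitzWith K v) (l : ℝ) :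
    ∃ K', LipschitzWith K' (dilQuot v l) := by
  have h1 := ((hv.comp (lipschitzWith_smul l)).sub hv)
  exact ⟨_, (lipschitzWith_smul (l - 1)⁻¹).comp h1⟩

/-- Soft thresholding at level `δ`. -/
def softThr (δ w : ℝ) : ℝ := max (w - δ) 0 - max (-w - δ) 0

lemma exists_lipschitzWith_softThr (δ : ℝ) : ∃ K, LipschitzWith K (softThr δ) := by
  have h1 : LipschitzWith 1 fun w : ℝ => w - δ := by
    simpa using LipschitzWith.id.sub (LipschitzWith.const δ)
  have h2 : LipschitzWith 1 fun w : ℝ => -w - δ := by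
    simpa using LipschitzWith.id.neg.sub (LipschitzWith.const δ)
  exact ⟨_, (h1.max_const 0).sub (h2.max_const 0)⟩

lemma continuous_softThr (δ : ℝ) : Continuous (softThr δ) := by
  unfold softThr; fun_prop

lemma softThr_eq_zero {δ w : ℝ} (h : |w| ≤ δ) : softThr δ w = 0 := by
  rw [abs_le] at h
  rw [softThr, max_eq_right (by linarith), max_eq_right (by linarith), sub_zero]

lemma abs_softThr_le {δ : ℝ} (hδ : 0 < δ) (w : ℝ) : |softThr δ w| ≤ |w| := by
  unfold softThr
  rcases max_cases (w - δ) 0 with h | h <;> rcases max_cases (-w - δ) 0 with h' | h' <;>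
    rcases abs_cases w with h'' | h'' <;> rw [abs_le] <;> constructor <;> linarith

lemma abs_softThr_sub_le {δ : ℝ} (hδ : 0 < δ) (w : ℝ) : |softThr δ w - w| ≤ δ := by
  unfold softThr
  rcases max_cases (w - δ) 0 with h | h <;> rcases max_cases (-w - δ) 0 with h' | h' <;>
    rw [abs_le] <;> constructor <;> linarith

lemma gradient_softThr_of_le {δ : ℝ} (hδ : 0 < δ) {w : E → ℝ} {x : E} (hw : ContinuousAt w x)
    (h : |w x| ≤ δ) : gradient (fun y => softThr δ (w y)) x = 0 := by
  have key : fderiv ℝ (fun y => softThr δ (w y)) x = 0 := by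
    rcases le_total 0 (w x) with h0 | h0
    · refine IsLocalMin.fderiv_eq_zero ?_
      have : ∀ᶠ y in nhds x, -δ < w y := hw.eventually (lt_mem_nhds (by linarith))
      filter_upwards [this] with y hy
      rw [softThr_eq_zero h, softThr, max_eq_right (by linarith : -w y - δ ≤ 0), sub_zero]
      exact le_max_right _ _
    · refine IsLocalMax.fderiv_eq_zero ?_
      have : ∀ᶠ y in nhds x, w y < δ := hw.eventually (gt_mem_nhds (by linarith))
      filter_upwards [this] with y hy
      rw [softThr_eq_zero h, softThr, max_eq_right (by linarith : w y - δ ≤ 0), zero_sub]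
      exact neg_nonpos.2 (le_max_right _ _)
  rw [← norm_eq_zero, norm_gradient, key, norm_zero]

lemma gradient_softThr_of_lt {δ : ℝ} (hδ : 0 < δ) {w : E → ℝ} {x : E}
    (hw : DifferentiableAt ℝ w x) (h : δ < |w x|) :
    gradient (fun y => softThr δ (w y)) x = gradient w x := by
  have key : fderiv ℝ (fun y => softThr δ (w y)) x = fderiv ℝ w x := by
    rcases lt_abs.1 h with h | h
    · have : ∀ᶠ y in nhds x, δ < w y := hw.continuousAt.eventually (lt_mem_nhds h)
      have h2 : (fun y => softThr δ (w y)) =ᶠ[nhds x] fun y => w y - δ := by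
        filter_upwards [this] with y hy
        rw [softThr, max_eq_left (by linarith), max_eq_right (by linarith), sub_zero]
      rw [h2.fderiv_eq, fderiv_sub_const]
    · have : ∀ᶠ y in nhds x, δ < -w y := hw.continuousAt.neg.eventually (lt_mem_nhds h)
      have h2 : (fun y => softThr δ (w y)) =ᶠ[nhds x] fun y => w y + δ := by
        filter_upwards [this] with y hy
        rw [softThr, max_eq_right (by linarith), max_eq_left (by linarith)]; ring
      rw [h2.fderiv_eq, fderiv_add_const]
  simp [gradient, key]

end GradientCalculus

section LipschitzProducts

variable {X : Type*} [PseudoMetricSpace X]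

lemma LipschitzWith.exists_mul_of_bounded {f g : X → ℝ} {K L : NNReal} {A B : ℝ}
    (hf : LipschitzWith K f) (hg : LipschitzWith L g) (hA : ∀ x, |f x| ≤ A)
    (hB : ∀ x, |g x| ≤ B) : ∃ K', LipschitzWith K' fun x => f x * g x := by
  refine ⟨Real.toNNReal (|A| * L + |B| * K), LipschitzWith.of_dist_le' fun x y => ?_⟩
  have h1 := hf.dist_le_mul x y
  have h2 := hg.dist_le_mul x y
  rw [Real.dist_eq] at h1 h2 ⊢
  calc |f x * g x - f y * g y| = |f x * (g x - g y) + g y * (f x - f y)| := by ring_nf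
    _ ≤ |f x| * |g x - g y| + |g y| * |f x - f y| := by
      rw [← abs_mul, ← abs_mul]; exact abs_add_le _ _
    _ ≤ |A| * (L * dist x y) + |B| * (K * dist x y) := by
      have hA' := (hA x).trans (le_abs_self A)
      have hB' := (hB y).trans (le_abs_self B)
      exact add_le_add (mul_le_mul hA' h2 (abs_nonneg _) (abs_nonneg _))
        (mul_le_mul hB' h1 (abs_nonneg _) (abs_nonneg _))
    _ = _ := by ring

end LipschitzProducts

section TestFunctions

variable {n : ℕ}

/-- Lipschitz functions supported in the open ball of radius `R`. -/
def IsTest (R : ℝ) (ξ : Euc n → ℝ) : Prop :=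
  (∃ K, LipschitzWith K ξ) ∧ tsupport ξ ⊆ ball 0 R

lemma IsTest.hasCompactSupport {R : ℝ} {ξ : Euc n → ℝ} (h : IsTest R ξ) : HasCompactSupport ξ :=
  (isCompact_closedBall (0 : Euc n) R).of_isClosed_subset (isClosed_tsupport ξ)
    (h.2.trans ball_subset_closedBall)

lemma IsTest.continuous {R : ℝ} {ξ : Euc n → ℝ} (h : IsTest R ξ) : Continuous ξ :=
  h.1.choose_spec.continuous

lemma IsTest.bounded {R : ℝ} {ξ : Euc n → ℝ} (h : IsTest R ξ) : ∃ C, ∀ x, |ξ x| ≤ C :=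
  h.hasCompactSupport.exists_bound_of_continuous h.continuous

lemma IsTest.gradient_bounded {R : ℝ} {ξ : Euc n → ℝ} (h : IsTest R ξ) :
    ∃ C, ∀ x, ‖gradient ξ x‖ ≤ C :=
  ⟨_, fun x => norm_gradient_le h.1.choose_spec x⟩

lemma IsTest.eq_zero {R : ℝ} {ξ : Euc n → ℝ} (h : IsTest R ξ) {x : Euc n} (hx : x ∉ ball 0 R) :
    ξ x = 0 :=
  image_eq_zero_of_notMem_tsupport fun hx' => hx (h.2 hx')

lemma IsTest.gradient_eq_zero {R : ℝ} {ξ : Euc n → ℝ} (h : IsTest R ξ) {x : Euc n}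
    (hx : x ∉ ball 0 R) : gradient ξ x = 0 :=
  gradient_eq_zero_of_notMem_tsupport fun hx' => hx (h.2 hx')

lemma IsTest.ae_differentiableAt {R : ℝ} {ξ : Euc n → ℝ} (h : IsTest R ξ) :
    ∀ᵐ x, DifferentiableAt ℝ ξ x :=
  h.1.choose_spec.ae_differentiableAt

lemma IsTest.mul_of_bounded {R C : ℝ} {ξ g : Euc n → ℝ} (h : IsTest R ξ)
    (hg : ∃ K, LipschitzWith K g) (hC : ∀ x, |g x| ≤ C) : IsTest R fun x => g x * ξ x :=
  ⟨hg.choose_spec.exists_mul_of_bounded h.1.choose_spec hC h.bounded.choose_spec,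
    tsupport_mul_subset_right.trans h.2⟩

/-- A product is a test function if one factor is a test function and the other is Lipschitz. -/
lemma IsTest.mul {R : ℝ} {ξ ζ : Euc n → ℝ} (h : IsTest R ξ) (h' : IsTest R ζ) :
    IsTest R fun x => ζ x * ξ x :=
  h.mul_of_bounded h'.1 h'.bounded.choose_spec

lemma integrable_of_bounded_of_ball {g : Euc n → ℝ} {C R : ℝ} (hg : AEStronglyMeasurable g)
    (h0 : ∀ x ∉ ball (0 : Euc n) R, g x = 0) (hC : ∀ x ∈ ball (0 : Euc n) R, |g x| ≤ C) :
    Integrable g := by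
  refine (integrableOn_iff_integrable_of_support_subset (s := ball (0 : Euc n) R)
    fun x hx => by_contra fun h => hx (h0 x h)).1 ?_
  refine Measure.integrableOn_of_bounded measure_ball_lt_top.ne hg (M := C) ?_
  exact (ae_restrict_mem measurableSet_ball).mono fun x hx => hC x hx

lemma tendsto_integral_of_bounded_of_ball {ι : Type*} {l : Filter ι} [l.IsCountablyGenerated]
    {F : ι → Euc n → ℝ} {g : Euc n → ℝ} {C R : ℝ} (hF : ∀ i, AEStronglyMeasurable (F i))
    (h0 : ∀ᶠ i in l, ∀ x ∉ ball (0 : Euc n) R, F i x = 0)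
    (hC : ∀ᶠ i in l, ∀ x ∈ ball (0 : Euc n) R, |F i x| ≤ C)
    (hlim : ∀ᵐ x, Tendsto (fun i => F i x) l (nhds (g x))) :
    Tendsto (fun i => ∫ x, F i x) l (nhds (∫ x, g x)) := by
  refine tendsto_integral_filter_of_dominated_convergence
    ((ball (0 : Euc n) R).indicator fun _ => C) (Eventually.of_forall hF) ?_ ?_ hlim
  · filter_upwards [h0, hC] with i h0 hC
    refine Eventually.of_forall fun x => ?_
    by_cases hx : x ∈ ball (0 : Euc n) R
    · rw [indicator_of_mem hx]; exact hC x hx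
    · rw [indicator_of_notMem hx, h0 x hx, norm_zero]
  · exact (integrable_indicator_iff measurableSet_ball).2
      (integrableOn_const measure_ball_lt_top.ne)

end TestFunctions
section Mollification

variable {n : ℕ}

lemma hasFDerivAt_normed_convolution (φ : ContDiffBump (0 : Euc n)) {ξ : Euc n → ℝ} {K : NNReal}
    (hξ : LipschitzWith K ξ) (x : Euc n) :
    HasFDerivAt (convolution (φ.normed volume) ξ (ContinuousLinearMap.lsmul ℝ ℝ) volume)
      (convolution (φ.normed volume) (fderiv ℝ ξ) (ContinuousLinearMap.lsmul ℝ ℝ) volume x) x := by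
  have hφ : Continuous (φ.normed volume) := φ.continuous_normed
  have hφi : Integrable (φ.normed volume) := φ.integrable_normed
  refine (hasFDerivAt_integral_of_dominated_loc_of_lip (s := univ) (μ := volume)
    (F := fun y t => (ContinuousLinearMap.lsmul ℝ ℝ) (φ.normed volume t) (ξ (y - t)))
    (bound := fun t => φ.normed volume t * K) univ_mem ?_ ?_ ?_ ?_ ?_ ?_).2
  · refine Eventually.of_forall fun y => Continuous.aestronglyMeasurable ?_
    simp only [ContinuousLinearMap.lsmul_apply]
    exact hφ.smul (hξ.continuous.comp (continuous_const.sub continuous_id))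
  · simp only [ContinuousLinearMap.lsmul_apply]
    refine Continuous.integrable_of_hasCompactSupport
      (hφ.smul (hξ.continuous.comp (continuous_const.sub continuous_id))) ?_
    exact φ.hasCompactSupport_normed.smul_right
  · simp only [ContinuousLinearMap.lsmul_apply]
    exact (hφ.measurable.smul ((measurable_fderiv ℝ ξ).comp
      (measurable_const.sub measurable_id))).aestronglyMeasurable
  · refine Eventually.of_forall fun t => LipschitzWith.lipschitzOnWith ?_
    refine LipschitzWith.of_dist_le_mul fun y z => ?_
    have h := hξ.dist_le_mul (y - t) (z - t)
    simp only [dist_sub_right] at h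
    simp only [ContinuousLinearMap.lsmul_apply, dist_smul₀, Real.coe_nnabs]
    have h0 := φ.nonneg_normed (μ := volume) t
    rw [Real.norm_of_nonneg h0, abs_of_nonneg (mul_nonneg h0 K.coe_nonneg), mul_assoc]
    gcongr
  · exact hφi.mul_const _
  · have := (quasiMeasurePreserving_sub_left volume x).ae
      (hξ.ae_differentiableAt (μ := (volume : Measure (Euc n))))
    filter_upwards [this] with t ht
    have h1 : HasFDerivAt (fun y => ξ (y - t)) (fderiv ℝ ξ (x - t)) x :=
      (hasFDerivAt_comp_sub t).2 ht.hasFDerivAt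
    exact h1.const_smul (φ.normed volume t)

/-- A weak equation tested against `C¹` functions also holds for Lipschitz test functions. -/
lemma weak_eq_of_isTest {R A B : ℝ} {Y : Euc n → Euc n} {F : Euc n → ℝ} (hY : Measurable Y)
    (hA : ∀ x, ‖Y x‖ ≤ A) (hF : Measurable F) (hB : ∀ x, |F x| ≤ B)
    (heq : ∀ ξ : Euc n → ℝ, ContDiff ℝ 1 ξ → HasCompactSupport ξ → tsupport ξ ⊆ ball 0 R →
      ∫ x, ⟪Y x, gradient ξ x⟫ = ∫ x, F x * ξ x)
    {ξ : Euc n → ℝ} (hξ : IsTest R ξ) : ∫ x, ⟪Y x, gradient ξ x⟫ = ∫ x, F x * ξ x := by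
  obtain ⟨K, hK⟩ := hξ.1
  obtain ⟨D, hD⟩ := hξ.bounded
  obtain ⟨r, hr, hsub⟩ := exists_lt_subset_ball (isClosed_tsupport ξ) hξ.2
  set s := (R - r) / 2 with hs
  have hs0 : 0 < s := by rw [hs]; linarith
  let φ : ℕ → ContDiffBump (0 : Euc n) := fun k =>
    ⟨s / (k + 1) / 2, s / (k + 1), by positivity, half_lt_self (by positivity)⟩
  have hφ : Tendsto (fun k => (φ k).rOut) atTop (nhds 0) := by
    have := (tendsto_one_div_add_atTop_nhds_zero_nat (𝕜 := ℝ)).const_mul s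
    simpa [φ, div_eq_mul_inv] using this
  have hφs : ∀ k, (φ k).rOut ≤ s := fun k => div_le_self hs0.le (by simp)
  let ξk : ℕ → Euc n → ℝ := fun k =>
    convolution ((φ k).normed volume) ξ (ContinuousLinearMap.lsmul ℝ ℝ) volume
  have hder : ∀ k x, HasFDerivAt (ξk k) _ x := fun k x => hasFDerivAt_normed_convolution (φ k) hK x
  have hsupp : ∀ k, tsupport (ξk k) ⊆ closedBall 0 (r + s) := fun k => by
    refine closure_minimal (fun x hx => ?_) isClosed_closedBall
    obtain ⟨a, ha, b, hb, rfl⟩ := support_convolution_subset_swap _ hx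
    have ha' := mem_ball_zero_iff.1 (hsub (subset_tsupport _ ha))
    rw [(φ k).support_normed_eq] at hb
    have hb' := mem_ball_zero_iff.1 hb
    rw [mem_closedBall_zero_iff]
    exact (norm_add_le _ _).trans (by linarith [hφs k])
  have hsub' : closedBall (0 : Euc n) (r + s) ⊆ ball 0 R :=
    closedBall_subset_ball (by rw [hs]; linarith)
  have hC1 : ∀ k, ContDiff ℝ 1 (ξk k) := fun k =>
    (φ k).hasCompactSupport_normed.contDiff_convolution_left (n := 1) _ (φ k).contDiff_normed
      hK.continuous.locallyIntegrable
  have hcs : ∀ k, HasCompactSupport (ξk k) := fun k =>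
    (isCompact_closedBall _ _).of_isClosed_subset (isClosed_tsupport _) (hsupp k)
  have hint : ∀ k, ∫ x, ⟪Y x, gradient (ξk k) x⟫ = ∫ x, F x * ξk k x := fun k =>
    heq _ (hC1 k) (hcs k) ((hsupp k).trans hsub')
  have hnb : ∀ k, ∀ x ∉ ball (0 : Euc n) R, x ∉ tsupport (ξk k) := fun k x hx hx' =>
    hx (hsub' (hsupp k hx'))
  have hnorm1 : ∀ k, ∫ t, (φ k).normed volume t = 1 := fun k => (φ k).integral_normed
  have hfd : ∀ x, ‖fderiv ℝ ξ x‖ ≤ K := fun x => norm_fderiv_le_of_lipschitz ℝ hK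
  have hbound : ∀ {V : Type} [NormedAddCommGroup V] [NormedSpace ℝ V] (g : Euc n → V) (L : ℝ),
      (∀ x, ‖g x‖ ≤ L) → ∀ k x, ‖convolution ((φ k).normed volume) g
        (ContinuousLinearMap.lsmul ℝ ℝ) volume x‖ ≤ L := by
    intro V _ _ g L hg k x
    have : L = ∫ t, (φ k).normed volume t * L := by
      rw [integral_mul_const, hnorm1, one_mul]
    rw [this]
    refine norm_integral_le_of_norm_le ((φ k).integrable_normed.mul_const L)
      (Eventually.of_forall fun t => ?_)
    rw [ContinuousLinearMap.lsmul_apply, norm_smul,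
      Real.norm_of_nonneg ((φ k).nonneg_normed t)]
    exact mul_le_mul_of_nonneg_left (hg _) ((φ k).nonneg_normed t)
  have hloc : LocallyIntegrable (fderiv ℝ ξ) := by
    intro x
    refine ⟨ball x 1, ball_mem_nhds x one_pos, ?_⟩
    exact Measure.integrableOn_of_bounded measure_ball_lt_top.ne
      (measurable_fderiv ℝ ξ).aestronglyMeasurable (M := K) (Eventually.of_forall hfd)
  have hae := ContDiffBump.ae_convolution_tendsto_right_of_locallyIntegrable (K := 2) hφ
    (Eventually.of_forall fun k => le_of_eq (by simp only [φ]; ring)) hloc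
  have hl1 : Tendsto (fun k => ∫ x, ⟪Y x, gradient (ξk k) x⟫) atTop
      (nhds (∫ x, ⟪Y x, gradient ξ x⟫)) := by
    refine tendsto_integral_of_bounded_of_ball (C := A * K) (R := R)
      (fun k => (hY.inner (measurable_gradient _)).aestronglyMeasurable) ?_ ?_ ?_
    · refine Eventually.of_forall fun k x hx => ?_
      rw [gradient_eq_zero_of_notMem_tsupport (hnb k x hx), inner_zero_right]
    · refine Eventually.of_forall fun k x _ => (abs_real_inner_le_norm _ _).trans ?_
      have : ‖gradient (ξk k) x‖ ≤ K := by
        rw [norm_gradient, (hder k x).fderiv]; exact hbound _ _ hfd k x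
      exact mul_le_mul (hA x) this (norm_nonneg _) ((norm_nonneg _).trans (hA x))
    · filter_upwards [hae] with x hx
      have : Tendsto (fun k => gradient (ξk k) x) atTop (nhds (gradient ξ x)) := by
        have h2 : (fun k => gradient (ξk k) x) = fun k => (InnerProductSpace.toDual ℝ (Euc n)).symm
            (convolution ((φ k).normed volume) (fderiv ℝ ξ) (ContinuousLinearMap.lsmul ℝ ℝ)
              volume x) := by
          ext1 k; rw [gradient, (hder k x).fderiv]
        rw [h2]
        exact ((InnerProductSpace.toDual ℝ (Euc n)).symm.continuous.tendsto _).comp hx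
      exact tendsto_const_nhds.inner this
  have hl2 : Tendsto (fun k => ∫ x, F x * ξk k x) atTop (nhds (∫ x, F x * ξ x)) := by
    refine tendsto_integral_of_bounded_of_ball (C := B * D) (R := R)
      (fun k => (hF.mul (hC1 k).continuous.measurable).aestronglyMeasurable) ?_ ?_ ?_
    · refine Eventually.of_forall fun k x hx => ?_
      rw [image_eq_zero_of_notMem_tsupport (hnb k x hx), mul_zero]
    · refine Eventually.of_forall fun k x _ => ?_
      rw [abs_mul]
      exact mul_le_mul (hB x) (hbound ξ D hD k x) (abs_nonneg _) ((abs_nonneg _).trans (hB x))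
    · refine Eventually.of_forall fun x => ?_
      exact (ContDiffBump.convolution_tendsto_right_of_continuous hφ hK.continuous x).const_mul _
  simp only [hint] at hl1
  exact tendsto_nhds_unique hl1 hl2

end Mollification
section Model

variable {n : ℕ} {p R : ℝ} {f : ℝ → ℝ} {v : Euc n → ℝ}

/-- A compactly supported `C¹` function `v` on the whole space which solves `-Δ_p v = f(v)` and is
stable with respect to Lipschitz functions supported in the ball of radius `R`. -/
structure IsStableModel (n : ℕ) (p R : ℝ) (f : ℝ → ℝ) (v : Euc n → ℝ) : Prop where
  contDiff_right : ContDiff ℝ 1 f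
  contDiff : ContDiff ℝ 1 v
  hasCompactSupport : HasCompactSupport v
  weak_eq : ∀ ξ : Euc n → ℝ, IsTest R ξ →
    ∫ x, ⟪pFlux p (gradient v x), gradient ξ x⟫ = ∫ x, f (v x) * ξ x
  stable : ∀ ξ : Euc n → ℝ, IsTest R ξ → ∫ x, deriv f (v x) * ξ x ^ 2 ≤
    ∫ x in {y | 0 < ‖gradient v y‖}, pHess p (gradient v x) (gradient ξ x) (gradient ξ x)

namespace IsStableModel

lemma differentiable (h : IsStableModel n p R f v) : Differentiable ℝ v :=
  h.contDiff.differentiable one_ne_zero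

lemma exists_lipschitzWith (h : IsStableModel n p R f v) : ∃ K, LipschitzWith K v :=
  h.contDiff.lipschitzWith_of_hasCompactSupport h.hasCompactSupport one_ne_zero

lemma exists_bound_comp (h : IsStableModel n p R f v) {g : ℝ → ℝ} (hg : Continuous g) :
    ∃ B, ∀ x, |g (v x)| ≤ B := by
  have hc := h.hasCompactSupport.isCompact_range h.contDiff.continuous
  obtain ⟨B, hB⟩ := hc.exists_bound_of_continuousOn hg.continuousOn
  exact ⟨B, fun x => hB _ (mem_range_self x)⟩

lemma norm_pFlux_gradient_le (hp : 1 < p) {K : NNReal} (hK : LipschitzWith K v) (x : Euc n) :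
    ‖pFlux p (gradient v x)‖ ≤ (K : ℝ) ^ (p - 1) := by
  rw [norm_pFlux hp]
  exact Real.rpow_le_rpow (norm_nonneg _) (norm_gradient_le hK x) (by linarith)

lemma measurable_pFlux_gradient : Measurable fun x => pFlux p (gradient v x) :=
  ((measurable_gradient v).norm.pow_const _).smul (measurable_gradient v)

lemma gradient_mul_self {η : Euc n → ℝ} {x : Euc n} (hx : DifferentiableAt ℝ η x) :
    gradient (fun y => η y * η y) x = (2 * η x) • gradient η x := by
  rw [gradient_mul hx hx, ← add_smul, two_mul]

lemma exists_bound_dilQuot {K : NNReal} (hK : LipschitzWith K v) (hR : R ≤ 1) (l : ℝ) {x : Euc n}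
    (hx : x ∈ ball (0 : Euc n) R) : |dilQuot v l x| ≤ K := by
  refine (abs_dilQuot_le hK l x).trans ?_
  have : ‖x‖ ≤ 1 := (mem_ball_zero_iff.1 hx).le.trans hR
  nlinarith [K.coe_nonneg]

lemma isTest_lipschitz_mul {g η : Euc n → ℝ} (hη : IsTest R η)
    (hg : ∃ K, LipschitzWith K g) : IsTest R fun x => g x * η x := by
  obtain ⟨K, hK⟩ := hg
  obtain ⟨C, hC⟩ := (isCompact_closedBall (0 : Euc n) R).exists_bound_of_continuousOn
    hK.continuous.continuousOn
  have hcl : LipschitzWith K fun x => max (-C) (min C (g x)) := (hK.const_min C).const_max (-C)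
  have hcb : ∀ x, |max (-C) (min C (g x))| ≤ |C| := fun x => by
    rcases max_cases (-C) (min C (g x)) with h | h <;> rcases min_cases C (g x) with h' | h' <;>
      rcases abs_cases C with h'' | h'' <;> rw [abs_le] <;> constructor <;> linarith
  have := hη.mul_of_bounded ⟨K, hcl⟩ hcb
  convert this using 2 with x
  by_cases hx : x ∈ ball (0 : Euc n) R
  · have h1 := abs_le.1 (hC x (ball_subset_closedBall hx))
    rw [min_eq_right h1.2, max_eq_right h1.1]
  · rw [hη.eq_zero hx, mul_zero, mul_zero]

lemma tendsto_scaling_integral (hp : 1 < p) {K : NNReal} (hK : LipschitzWith K v) {q : Euc n → ℝ}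
    (hq : IsTest R q) (hR : R ≤ 1) :
    Tendsto (fun l : ℝ => ∫ x, ‖gradient v x‖ ^ p *
        (l ^ (p - n) * ((l - 1)⁻¹ * (q (l⁻¹ • x) - q x)) + ((l ^ (p - n) - 1) * (l - 1)⁻¹) * q x))
      (nhdsWithin 1 (Ioi 1))
      (nhds (∫ x, ‖gradient v x‖ ^ p * ((p - n) * q x - ⟪x, gradient q x⟫))) := by
  obtain ⟨L, hL⟩ := hq.1
  obtain ⟨D, hD⟩ := hq.bounded
  have hle : nhdsWithin (1 : ℝ) (Ioi 1) ≤ nhdsWithin 1 {1}ᶜ :=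
    nhdsWithin_mono _ fun l hl => ne_of_gt hl
  have hpow : HasDerivAt (fun l : ℝ => l ^ (p - n)) (p - n) 1 := by
    simpa using Real.hasDerivAt_rpow_const (x := 1) (p := p - n) (Or.inl one_ne_zero)
  have hpow1 : Tendsto (fun l : ℝ => l ^ (p - n)) (nhdsWithin 1 (Ioi 1)) (nhds 1) := by
    have := hpow.continuousAt.tendsto
    rw [Real.one_rpow] at this
    exact this.mono_left nhdsWithin_le_nhds
  have hpow2 : Tendsto (fun l : ℝ => (l ^ (p - n) - 1) * (l - 1)⁻¹) (nhdsWithin 1 (Ioi 1))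
      (nhds (p - n)) := by
    have := hpow.tendsto_slope.mono_left hle
    simpa [slope_fun_def, mul_comm] using this
  have hgp : ∀ x, ‖gradient v x‖ ^ p ≤ (K : ℝ) ^ p := fun x =>
    Real.rpow_le_rpow (norm_nonneg _) (norm_gradient_le hK x) (by linarith)
  have hmq : Measurable q := hL.continuous.measurable
  have hl1 : ∀ᶠ l : ℝ in nhdsWithin 1 (Ioi 1), 1 < l := self_mem_nhdsWithin
  have hl2 : ∀ᶠ l : ℝ in nhdsWithin 1 (Ioi 1), l < 2 :=
    mem_nhdsWithin_of_mem_nhds (gt_mem_nhds (by norm_num))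
  refine tendsto_integral_of_bounded_of_ball (R := 2)
    (C := (K : ℝ) ^ p * (2 * (L * 2) + (|p - n| + 1) * D)) (fun l => ?_) ?_ ?_ ?_
  · have := measurable_gradient v
    have h2 : Measurable fun x : Euc n => q (l⁻¹ • x) := hmq.comp (measurable_const_smul _)
    exact (by fun_prop : Measurable _).aestronglyMeasurable
  · filter_upwards [hl1, hl2] with l h1 h2 x hx
    have hx2 : 2 ≤ ‖x‖ := by rwa [mem_ball_zero_iff, not_lt] at hx
    have h3 : q x = 0 := hq.eq_zero fun h => by rw [mem_ball_zero_iff] at h; linarith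
    have h4 : q (l⁻¹ • x) = 0 := hq.eq_zero fun h => by
      rw [mem_ball_zero_iff, norm_smul, norm_inv, Real.norm_of_nonneg (by linarith),
        inv_mul_lt_iff₀ (by linarith)] at h
      nlinarith
    rw [h3, h4]; ring
  · have hb2 : ∀ᶠ l : ℝ in nhdsWithin 1 (Ioi 1), |(l ^ (p - n) - 1) * (l - 1)⁻¹| < |p - n| + 1 :=
      hpow2.abs.eventually (gt_mem_nhds (by linarith))
    filter_upwards [hl1, hl2, hb2, hpow1.eventually (gt_mem_nhds (by norm_num : (1 : ℝ) < 2))]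
      with l h1 h2 h3 h4 x hx
    have hx2 : ‖x‖ < 2 := mem_ball_zero_iff.1 hx
    have hl0 : 0 < l := by linarith
    have h5 : |(l - 1)⁻¹ * (q (l⁻¹ • x) - q x)| ≤ L * 2 := by
      have h6 := hL.dist_le_mul (l⁻¹ • x) x
      have h7 : l⁻¹ • x - x = (l⁻¹ - 1) • x := by rw [sub_smul, one_smul]
      have h8 : |l⁻¹ - 1| ≤ l - 1 := by
        have : l⁻¹ - 1 = -((l - 1) / l) := by field_simp; ring
        rw [this, abs_neg, abs_of_pos (div_pos (by linarith) hl0)]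
        exact div_le_self (by linarith) h1.le
      rw [Real.dist_eq, dist_eq_norm, h7, norm_smul, Real.norm_eq_abs] at h6
      rw [abs_mul, abs_inv, abs_of_pos (by linarith : 0 < l - 1),
        inv_mul_le_iff₀ (by linarith : 0 < l - 1)]
      calc _ ≤ (L : ℝ) * (|l⁻¹ - 1| * ‖x‖) := h6
        _ ≤ L * ((l - 1) * 2) := by gcongr
        _ = _ := by ring
    rw [abs_mul, abs_of_nonneg (Real.rpow_nonneg (norm_nonneg _) _)]
    refine mul_le_mul (hgp x) ((abs_add_le _ _).trans (add_le_add ?_ ?_)) (abs_nonneg _)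
      (by positivity)
    · rw [abs_mul, abs_of_nonneg (Real.rpow_nonneg hl0.le _)]
      exact mul_le_mul h4.le h5 (abs_nonneg _) zero_le_two
    · rw [abs_mul]
      exact mul_le_mul h3.le (hD x) (abs_nonneg _) (by positivity)
  · filter_upwards [hq.ae_differentiableAt] with x hx
    refine Tendsto.const_mul _ ?_
    have hd : HasDerivAt (fun l : ℝ => q (l⁻¹ • x)) (-⟪x, gradient q x⟫) 1 := by
      have h1 : HasDerivAt (fun l : ℝ => l⁻¹ • x) (-x) 1 := by
        simpa using (hasDerivAt_inv (one_ne_zero (α := ℝ))).smul_const x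
      have hx' : HasFDerivAt q (fderiv ℝ q x) ((1 : ℝ)⁻¹ • x) := by simpa using hx.hasFDerivAt
      have := hx'.comp_hasDerivAt 1 h1
      rw [map_neg] at this
      rw [inner_gradient_right]
      exact this
    have h2 : Tendsto (fun l : ℝ => (l - 1)⁻¹ * (q (l⁻¹ • x) - q x)) (nhdsWithin 1 (Ioi 1))
        (nhds (-⟪x, gradient q x⟫)) := by
      have := hd.tendsto_slope.mono_left hle
      simpa [slope_fun_def] using this
    have := (hpow1.mul h2).add (hpow2.mul_const (q x))
    convert this using 2
    ring

/-- One-sided Pohozaev inequality with the radial vector field `x q`. -/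
lemma pohozaev_le (h : IsStableModel n p R f v) (hp : 1 < p) (hR : R ≤ 1) {q : Euc n → ℝ}
    (hq : IsTest R q) (hq0 : ∀ x, 0 ≤ q x) :
    ∫ x, f (v x) * (⟪x, gradient v x⟫ * q x) ≤
      (∫ x, ⟪x, gradient v x⟫ * ⟪pFlux p (gradient v x), gradient q x⟫) +
      p⁻¹ * ∫ x, ‖gradient v x‖ ^ p * ((p - n) * q x - ⟪x, gradient q x⟫) := by
  obtain ⟨K, hK⟩ := h.exists_lipschitzWith
  obtain ⟨B, hB⟩ := h.exists_bound_comp h.contDiff_right.continuous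
  obtain ⟨D, hD⟩ := hq.bounded
  obtain ⟨L, hL⟩ := hq.gradient_bounded
  have hle : nhdsWithin (1 : ℝ) (Ioi 1) ≤ nhdsWithin 1 {1}ᶜ :=
    nhdsWithin_mono _ fun l hl => ne_of_gt hl
  have hmg := measurable_gradient v
  have hmq : Measurable q := hq.continuous.measurable
  have hmdq : ∀ l, Measurable (dilQuot v l) := fun l =>
    (exists_lipschitzWith_dilQuot hK l).choose_spec.continuous.measurable
  have hmf : Measurable fun x => f (v x) :=
    (h.contDiff_right.continuous.comp h.contDiff.continuous).measurable
  have hmY : Measurable fun x => pFlux p (gradient v x) := measurable_pFlux_gradient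
  have hlimA : Tendsto (fun l => ∫ x, f (v x) * (dilQuot v l x * q x)) (nhdsWithin 1 (Ioi 1))
      (nhds (∫ x, f (v x) * (⟪x, gradient v x⟫ * q x))) := by
    refine tendsto_integral_of_bounded_of_ball (C := B * (K * D)) (R := R)
      (fun l => (hmf.mul ((hmdq l).mul hmq)).aestronglyMeasurable) ?_ ?_ ?_
    · exact Eventually.of_forall fun l x hx => by rw [hq.eq_zero hx]; ring
    · refine Eventually.of_forall fun l x hx => ?_
      rw [abs_mul, abs_mul]
      have := exists_bound_dilQuot hK hR l hx
      exact mul_le_mul (hB x) (mul_le_mul this (hD x) (abs_nonneg _) K.2) (by positivity)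
        ((abs_nonneg _).trans (hB x))
    · exact Eventually.of_forall fun x =>
        (((tendsto_dilQuot h.differentiable x).mono_left hle).mul_const _).const_mul _
  have hYb := norm_pFlux_gradient_le (v := v) hp hK
  have hlimB : Tendsto (fun l => ∫ x, dilQuot v l x * ⟪pFlux p (gradient v x), gradient q x⟫)
      (nhdsWithin 1 (Ioi 1))
      (nhds (∫ x, ⟪x, gradient v x⟫ * ⟪pFlux p (gradient v x), gradient q x⟫)) := by
    refine tendsto_integral_of_bounded_of_ball (C := K * ((K : ℝ) ^ (p - 1) * L)) (R := R)
      (fun l => ((hmdq l).mul (hmY.inner (measurable_gradient q))).aestronglyMeasurable) ?_ ?_ ?_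
    · exact Eventually.of_forall fun l x hx => by
        rw [hq.gradient_eq_zero hx, inner_zero_right, mul_zero]
    · refine Eventually.of_forall fun l x hx => ?_
      rw [abs_mul]
      exact mul_le_mul (exists_bound_dilQuot hK hR l hx) ((abs_real_inner_le_norm _ _).trans
        (mul_le_mul (hYb x) (hL x) (norm_nonneg _) (by positivity))) (abs_nonneg _) K.2
    · exact Eventually.of_forall fun x =>
        ((tendsto_dilQuot h.differentiable x).mono_left hle).mul_const _
  have hlimC := tendsto_scaling_integral (R := R) hp hK hq hR
  have hl1 : ∀ᶠ l : ℝ in nhdsWithin 1 (Ioi 1), 1 < l := self_mem_nhdsWithin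
  refine le_of_tendsto_of_tendsto hlimA (hlimB.add (hlimC.const_mul p⁻¹)) ?_
  filter_upwards [hl1] with l hl
  have hl0 : 0 < l := by linarith
  have hp0 : 0 < p := by linarith
  have htest := isTest_lipschitz_mul hq (exists_lipschitzWith_dilQuot hK l)
  have hweak := h.weak_eq _ htest
  have hgrad : ∀ᵐ x, gradient (fun y => dilQuot v l y * q y) x =
      dilQuot v l x • gradient q x +
        q x • ((l - 1)⁻¹ • (l • gradient v (l • x) - gradient v x)) := by
    filter_upwards [hq.ae_differentiableAt] with x hx
    have hd := hasGradientAt_dilQuot h.differentiable l x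
    rw [gradient_mul hd.differentiableAt hx, hd.gradient]
  have hGb : ∀ x, ‖gradient v x‖ ^ p ≤ (K : ℝ) ^ p := fun x =>
    Real.rpow_le_rpow (norm_nonneg _) (norm_gradient_le hK x) (by linarith)
  have hmgl : Measurable fun x => gradient v (l • x) := hmg.comp (measurable_const_smul l)
  have hmql : Measurable fun x => q (l⁻¹ • x) := hmq.comp (measurable_const_smul l⁻¹)
  have hIB : Integrable fun x => dilQuot v l x * ⟪pFlux p (gradient v x), gradient q x⟫ := by
    refine integrable_of_bounded_of_ball (C := K * ((K : ℝ) ^ (p - 1) * L)) (R := R)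
      ((hmdq l).mul (hmY.inner (measurable_gradient q))).aestronglyMeasurable ?_ ?_
    · exact fun x hx => by rw [hq.gradient_eq_zero hx, inner_zero_right, mul_zero]
    · intro x hx
      rw [abs_mul]
      exact mul_le_mul (exists_bound_dilQuot hK hR l hx) ((abs_real_inner_le_norm _ _).trans
        (mul_le_mul (hYb x) (hL x) (norm_nonneg _) (by positivity))) (abs_nonneg _) K.2
  have hI1 : Integrable fun x => ‖l • gradient v (l • x)‖ ^ p * q x := by
    refine integrable_of_bounded_of_ball (C := (l * K) ^ p * D) (R := R)
      (by fun_prop : Measurable _).aestronglyMeasurable ?_ ?_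
    · exact fun x hx => by rw [hq.eq_zero hx, mul_zero]
    · intro x hx
      rw [abs_mul, abs_of_nonneg (Real.rpow_nonneg (norm_nonneg _) _)]
      refine mul_le_mul (Real.rpow_le_rpow (norm_nonneg _) ?_ hp0.le) (hD x) (abs_nonneg _)
        (by positivity)
      rw [norm_smul, Real.norm_of_nonneg hl0.le]
      exact mul_le_mul_of_nonneg_left (norm_gradient_le hK _) hl0.le
  have hI2 : Integrable fun x => ‖gradient v x‖ ^ p * q x := by
    refine integrable_of_bounded_of_ball (C := (K : ℝ) ^ p * D) (R := R)
      (by fun_prop : Measurable _).aestronglyMeasurable ?_ ?_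
    · exact fun x hx => by rw [hq.eq_zero hx, mul_zero]
    · intro x hx
      rw [abs_mul, abs_of_nonneg (Real.rpow_nonneg (norm_nonneg _) _)]
      exact mul_le_mul (hGb x) (hD x) (abs_nonneg _) (by positivity)
  have hI3 : Integrable fun x => ‖gradient v x‖ ^ p * q (l⁻¹ • x) := by
    refine integrable_of_bounded_of_ball (C := (K : ℝ) ^ p * D) (R := l * R)
      (by fun_prop : Measurable _).aestronglyMeasurable ?_ ?_
    · intro x hx
      rw [hq.eq_zero, mul_zero]
      rwa [mem_ball_zero_iff, norm_smul, norm_inv, Real.norm_of_nonneg hl0.le,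
        inv_mul_lt_iff₀ hl0, ← mem_ball_zero_iff]
    · intro x hx
      rw [abs_mul, abs_of_nonneg (Real.rpow_nonneg (norm_nonneg _) _)]
      exact mul_le_mul (hGb x) (hD _) (abs_nonneg _) (by positivity)
  have hscale : ∫ x, ‖l • gradient v (l • x)‖ ^ p * q x =
      l ^ (p - n) * ∫ x, ‖gradient v x‖ ^ p * q (l⁻¹ • x) := by
    have h1 := Measure.integral_comp_smul (volume : Measure (Euc n))
      (fun x => ‖gradient v x‖ ^ p * q (l⁻¹ • x)) l
    simp only [inv_smul_smul₀ hl0.ne', finrank_euclideanSpace, Fintype.card_fin, smul_eq_mul] at h1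
    rw [abs_of_pos (by positivity)] at h1
    have h2 : ∀ x, ‖l • gradient v (l • x)‖ ^ p * q x =
        l ^ p * (‖gradient v (l • x)‖ ^ p * q x) := fun x => by
      rw [norm_smul, Real.norm_of_nonneg hl0.le, Real.mul_rpow hl0.le (norm_nonneg _), mul_assoc]
    simp only [h2]
    rw [integral_const_mul, h1, Real.rpow_sub hl0, Real.rpow_natCast]
    ring
  have hI12 : Integrable fun x => p⁻¹ * ((l - 1)⁻¹ *
      (‖l • gradient v (l • x)‖ ^ p * q x - ‖gradient v x‖ ^ p * q x)) :=
    ((hI1.sub hI2).const_mul _).const_mul _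
  calc ∫ x, f (v x) * (dilQuot v l x * q x)
      = ∫ x, ⟪pFlux p (gradient v x), gradient (fun y => dilQuot v l y * q y) x⟫ := hweak.symm
    _ = ∫ x, (dilQuot v l x * ⟪pFlux p (gradient v x), gradient q x⟫ +
          q x * ((l - 1)⁻¹ * ⟪pFlux p (gradient v x), l • gradient v (l • x) - gradient v x⟫)) := by
      refine integral_congr_ae ?_
      filter_upwards [hgrad] with x hx
      rw [hx, inner_add_right, real_inner_smul_right, real_inner_smul_right, real_inner_smul_right]
    _ ≤ ∫ x, (dilQuot v l x * ⟪pFlux p (gradient v x), gradient q x⟫ +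
          p⁻¹ * ((l - 1)⁻¹ * (‖l • gradient v (l • x)‖ ^ p * q x - ‖gradient v x‖ ^ p * q x))) := by
      have hI4 : Integrable fun x =>
          q x * ((l - 1)⁻¹ * ⟪pFlux p (gradient v x), l • gradient v (l • x) - gradient v x⟫) := by
        refine integrable_of_bounded_of_ball
          (C := D * (|(l - 1)⁻¹| * ((K : ℝ) ^ (p - 1) * (l * K + K)))) (R := R)
          (hmq.mul (((hmY.inner ((hmgl.const_smul l).sub hmg))).const_mul _)).aestronglyMeasurable
          ?_ ?_
        · exact fun x hx => by rw [hq.eq_zero hx, zero_mul]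
        · intro x hx
          rw [abs_mul, abs_mul]
          have h1 : ‖l • gradient v (l • x) - gradient v x‖ ≤ l * K + K := by
            refine (norm_sub_le _ _).trans (add_le_add ?_ (norm_gradient_le hK _))
            rw [norm_smul, Real.norm_of_nonneg hl0.le]
            exact mul_le_mul_of_nonneg_left (norm_gradient_le hK _) hl0.le
          have h2 := (abs_real_inner_le_norm (pFlux p (gradient v x))
            (l • gradient v (l • x) - gradient v x)).trans
            (mul_le_mul (hYb x) h1 (norm_nonneg _) (by positivity))
          exact mul_le_mul (hD x) (mul_le_mul_of_nonneg_left h2 (abs_nonneg _)) (by positivity)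
            ((abs_nonneg _).trans (hD x))
      refine integral_mono (hIB.add hI4) (hIB.add hI12) fun x => ?_
      refine add_le_add le_rfl ?_
      have hc := inner_pFlux_sub_le hp (gradient v x) (l • gradient v (l • x))
      have hl' : 0 ≤ (l - 1)⁻¹ := inv_nonneg.2 (by linarith)
      calc _ ≤ q x * ((l - 1)⁻¹ *
            ((‖l • gradient v (l • x)‖ ^ p - ‖gradient v x‖ ^ p) / p)) :=
            mul_le_mul_of_nonneg_left (mul_le_mul_of_nonneg_left hc hl') (hq0 x)
        _ = _ := by rw [div_eq_mul_inv]; ring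
    _ = (∫ x, dilQuot v l x * ⟪pFlux p (gradient v x), gradient q x⟫) +
          p⁻¹ * ((l - 1)⁻¹ * (l ^ (p - n) * (∫ x, ‖gradient v x‖ ^ p * q (l⁻¹ • x)) -
            ∫ x, ‖gradient v x‖ ^ p * q x)) := by
      rw [integral_add hIB hI12, integral_const_mul,
        integral_const_mul, integral_sub hI1 hI2, hscale]
    _ = _ := by
      congr 2
      rw [← integral_const_mul, ← integral_sub (hI3.const_mul _) hI2, ← integral_const_mul]
      refine integral_congr_ae (Eventually.of_forall fun x => ?_)
      ring

end IsStableModel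

end Model

section PointwiseEstimates

variable {E : Type*} [NormedAddCommGroup E] [InnerProductSpace ℝ E]

lemma min_le_rpow_and_rpow_le_max {m M t : ℝ} (q : ℝ) (hm : 0 < m) (h1 : m ≤ t) (h2 : t ≤ M) :
    min (m ^ q) (M ^ q) ≤ t ^ q ∧ t ^ q ≤ max (m ^ q) (M ^ q) := by
  have ht : 0 < t := hm.trans_le h1
  rcases le_total 0 q with hq | hq
  · exact ⟨(min_le_left _ _).trans (Real.rpow_le_rpow hm.le h1 hq),
      (Real.rpow_le_rpow ht.le h2 hq).trans (le_max_right _ _)⟩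
  · exact ⟨(min_le_right _ _).trans (Real.rpow_le_rpow_of_nonpos ht h2 hq),
      (Real.rpow_le_rpow_of_nonpos hm h1 hq).trans (le_max_left _ _)⟩

lemma pHess_smul_add_smul_self (p s g : ℝ) (a z e : E) :
    pHess p a (s • z + g • e) (s • z + g • e) =
      pHess p a z (s ^ 2 • z + (2 * (g * s)) • e) + g ^ 2 * pHess p a e e := by
  simp only [pHess, inner_add_left, inner_add_right, real_inner_smul_left, real_inner_smul_right,
    real_inner_comm z e]
  ring

lemma le_inner_of_norm_sub_pFluxDeriv_le {p c ε s g : ℝ} {a z e d : E} (hc : 0 < c) (hε : 0 ≤ ε)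
    (hH : ∀ y, c * ‖y‖ ^ 2 ≤ pHess p a y y) (hd : ‖d - pFluxDeriv p a z‖ ≤ ε * ‖z‖) :
    (1 - 4 * ε / c) * pHess p a (s • z + g • e) (s • z + g • e) - g ^ 2 * pHess p a e e
        - 5 * ε * (g ^ 2 * ‖e‖ ^ 2) ≤ ⟪d, s ^ 2 • z + (2 * (g * s)) • e⟫ := by
  set y := s • z + g • e with hy
  set w := s ^ 2 • z + (2 * (g * s)) • e with hw
  have h1 : ⟪d, w⟫ = ⟪d - pFluxDeriv p a z, w⟫ + (pHess p a y y - g ^ 2 * pHess p a e e) := by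
    rw [pHess_smul_add_smul_self, ← inner_pFluxDeriv, inner_sub_left]
    ring
  have h2 : |⟪d - pFluxDeriv p a z, w⟫| ≤
      ε * ‖z‖ * (s ^ 2 * ‖z‖ + 2 * (|g| * |s|) * ‖e‖) := by
    refine (abs_real_inner_le_norm _ _).trans (mul_le_mul hd ?_ (norm_nonneg _) (by positivity))
    refine (norm_add_le _ _).trans_eq ?_
    rw [norm_smul, norm_smul, Real.norm_of_nonneg (sq_nonneg s), Real.norm_eq_abs, abs_mul,
      abs_mul, abs_two]
  have h3 : ‖s • z‖ ≤ ‖y‖ + ‖g • e‖ := by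
    have : s • z = y - g • e := by rw [hy]; abel
    rw [this]
    exact norm_sub_le _ _
  rw [norm_smul, norm_smul, Real.norm_eq_abs, Real.norm_eq_abs] at h3
  have h4 : ‖z‖ * (s ^ 2 * ‖z‖ + 2 * (|g| * |s|) * ‖e‖) ≤ 4 * ‖y‖ ^ 2 + 5 * (g ^ 2 * ‖e‖ ^ 2) := by
    have e1 : s ^ 2 = |s| ^ 2 := (sq_abs s).symm
    have e2 : g ^ 2 = |g| ^ 2 := (sq_abs g).symm
    rw [e1, e2]
    have hA : 0 ≤ |s| * ‖z‖ := by positivity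
    have hB : 0 ≤ |g| * ‖e‖ := by positivity
    set A := |s| * ‖z‖
    set B := |g| * ‖e‖
    have : A ^ 2 ≤ 2 * ‖y‖ ^ 2 + 2 * B ^ 2 := by
      nlinarith [pow_le_pow_left₀ hA h3 2, sq_nonneg (‖y‖ - B)]
    calc _ = A ^ 2 + 2 * A * B := by simp only [A, B]; ring
      _ ≤ 4 * ‖y‖ ^ 2 + 5 * B ^ 2 := by nlinarith [sq_nonneg (A - B)]
      _ = _ := by simp only [B]; ring
  have h5 : ‖y‖ ^ 2 ≤ pHess p a y y / c := by rw [le_div_iff₀ hc]; linarith [hH y]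
  have h6 := mul_le_mul_of_nonneg_left h4 hε
  have h7 := mul_le_mul_of_nonneg_left h5 hε
  have h8 := (abs_le.1 h2).1
  have h9 : 4 * ε / c * pHess p a y y = 4 * (ε * (pHess p a y y / c)) := by ring
  rw [h1, sub_mul, h9]
  nlinarith

end PointwiseEstimates

section Linearized

variable {n : ℕ} {p R : ℝ} {f : ℝ → ℝ} {v : Euc n → ℝ}

lemma IsTest.comp_inv_smul {ξ : Euc n → ℝ} (hξ : IsTest R ξ) {l : ℝ} (hl0 : 0 < l) (hl1 : l ≤ 1) :
    IsTest R fun x => ξ (l⁻¹ • x) := by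
  obtain ⟨K, hK⟩ := hξ.1
  refine ⟨⟨_, hK.comp (lipschitzWith_smul l⁻¹)⟩, fun x hx => ?_⟩
  have h1 : l⁻¹ • x ∈ tsupport ξ :=
    tsupport_comp_subset_preimage (f := fun x : Euc n => l⁻¹ • x) ξ (continuous_const_smul _) hx
  have h2 := mem_ball_zero_iff.1 (hξ.2 h1)
  rw [norm_smul, norm_inv, Real.norm_of_nonneg hl0.le, inv_mul_lt_iff₀ hl0] at h2
  have hR : 0 < R := by nlinarith [norm_nonneg x]
  rw [mem_ball_zero_iff]
  nlinarith

lemma gradient_comp_smul (ξ : Euc n → ℝ) (l : ℝ) (x : Euc n) :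
    gradient (fun y => ξ (l • y)) x = l • gradient ξ (l • x) := by
  simp only [gradient]
  rw [fderiv_comp_smul, map_smul]

namespace IsStableModel

/-- The equation satisfied by the dilation `x ↦ v (l x)`. -/
lemma weak_eq_dilation (h : IsStableModel n p R f v) (hp : 1 < p) {ξ : Euc n → ℝ}
    (hξ : IsTest R ξ) {l : ℝ} (hl0 : 0 < l) (hl1 : l ≤ 1) :
    ∫ x, ⟪pFlux p (l • gradient v (l • x)), gradient ξ x⟫ = ∫ x, l ^ p * f (v (l • x)) * ξ x := by
  have h1 := h.weak_eq _ (hξ.comp_inv_smul hl0 hl1)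
  have h2 := Measure.integral_comp_smul (volume : Measure (Euc n))
    (fun x => ⟪pFlux p (gradient v x), gradient (fun y => ξ (l⁻¹ • y)) x⟫) l
  have h3 := Measure.integral_comp_smul (volume : Measure (Euc n))
    (fun x => f (v x) * ξ (l⁻¹ • x)) l
  rw [h1, ← h3] at h2
  simp only [gradient_comp_smul, inv_smul_smul₀ hl0.ne', real_inner_smul_right] at h2
  rw [integral_const_mul] at h2
  simp only [pFlux_smul hp hl0.le, real_inner_smul_left, mul_assoc]
  rw [integral_const_mul, integral_const_mul, ← h2, ← mul_assoc, Real.rpow_sub_one hl0.ne',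
    div_eq_mul_inv]

lemma weak_eq_quotient (h : IsStableModel n p R f v) (hp : 1 < p) {ξ : Euc n → ℝ}
    (hξ : IsTest R ξ) {l : ℝ} (hl0 : 0 < l) (hl1 : l ≤ 1) :
    ∫ x, ⟪(l - 1)⁻¹ • (pFlux p (l • gradient v (l • x)) - pFlux p (gradient v x)), gradient ξ x⟫ =
      ∫ x, (l - 1)⁻¹ * (l ^ p * f (v (l • x)) - f (v x)) * ξ x := by
  obtain ⟨K, hK⟩ := h.exists_lipschitzWith
  obtain ⟨B, hB⟩ := h.exists_bound_comp h.contDiff_right.continuous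
  obtain ⟨D, hD⟩ := hξ.bounded
  obtain ⟨L, hL⟩ := hξ.gradient_bounded
  have hmg := measurable_gradient v
  have hmξ : Measurable ξ := hξ.continuous.measurable
  have hmf : Measurable fun x => f (v x) :=
    (h.contDiff_right.continuous.comp h.contDiff.continuous).measurable
  have hmY : Measurable fun x => pFlux p (gradient v x) := measurable_pFlux_gradient
  have hYb := norm_pFlux_gradient_le (v := v) hp hK
  have hI1 : ∀ t : ℝ, Integrable fun x => ⟪pFlux p (gradient v (t • x)), gradient ξ x⟫ := fun t => by
    refine integrable_of_bounded_of_ball (C := (K : ℝ) ^ (p - 1) * L) (R := R)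
      ((hmY.comp (measurable_const_smul t)).inner (measurable_gradient ξ)).aestronglyMeasurable ?_ ?_
    · exact fun x hx => by rw [hξ.gradient_eq_zero hx, inner_zero_right]
    · exact fun x hx => (abs_real_inner_le_norm _ _).trans
        (mul_le_mul (hYb _) (hL x) (norm_nonneg _) (by positivity))
  have hI2 : ∀ t : ℝ, Integrable fun x => f (v (t • x)) * ξ x := fun t => by
    refine integrable_of_bounded_of_ball (C := B * D) (R := R)
      ((hmf.comp (measurable_const_smul t)).mul hmξ).aestronglyMeasurable ?_ ?_
    · exact fun x hx => by rw [hξ.eq_zero hx, mul_zero]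
    · exact fun x hx => by
        rw [abs_mul]
        exact mul_le_mul (hB _) (hD x) (abs_nonneg _) ((abs_nonneg _).trans (hB x))
  have hd := h.weak_eq_dilation hp hξ hl0 hl1
  have h0 := h.weak_eq ξ hξ
  have hI1' := hI1 1
  have hI2' := hI2 1
  simp only [one_smul] at hI1' hI2'
  simp only [pFlux_smul hp hl0.le] at hd ⊢
  simp only [real_inner_smul_left, inner_sub_left, mul_assoc, sub_mul] at hd ⊢
  rw [integral_const_mul, integral_const_mul, integral_sub ((hI1 l).const_mul _) hI1', hd, h0,
    integral_sub ((hI2 l).const_mul _) hI2']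

lemma uniformContinuous_gradient (h : IsStableModel n p R f v) :
    UniformContinuous (gradient v) := by
  refine HasCompactSupport.uniformContinuous_of_continuous (h.hasCompactSupport.mono' ?_)
    (continuous_gradient h.contDiff)
  exact fun x hx => by_contra fun hx' => hx (gradient_eq_zero_of_notMem_tsupport hx')

lemma exists_gradient_close (h : IsStableModel n p R f v) {γ : ℝ} (hγ : 0 < γ) :
    ∃ τ > 0, ∀ l : ℝ, |l - 1| < τ → ∀ x ∈ ball (0 : Euc n) 1,
      ‖gradient v (l • x) - gradient v x‖ < γ := by
  obtain ⟨τ, hτ, h1⟩ := Metric.uniformContinuous_iff.1 h.uniformContinuous_gradient γ hγ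
  refine ⟨τ, hτ, fun l hl x hx => ?_⟩
  rw [← dist_eq_norm]
  refine h1 (lt_of_le_of_lt ?_ hl)
  have h2 : l • x - x = (l - 1) • x := by rw [sub_smul, one_smul]
  rw [dist_eq_norm, h2, norm_smul, Real.norm_eq_abs]
  exact mul_le_of_le_one_right (abs_nonneg _) (mem_ball_zero_iff.1 hx).le

lemma eventually_norm_smul_gradient_sub_le (h : IsStableModel n p R f v) {γ : ℝ} (hγ : 0 < γ) :
    ∀ᶠ l : ℝ in nhds 1, ∀ x ∈ ball (0 : Euc n) 1,
      ‖l • gradient v (l • x) - gradient v x‖ ≤ γ := by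
  obtain ⟨K, hK⟩ := h.exists_lipschitzWith
  obtain ⟨τ, hτ, h1⟩ := h.exists_gradient_close (half_pos hγ)
  have hK0 := K.coe_nonneg
  have h2 : 0 < min τ (γ / 2 / (K + 1)) := by positivity
  filter_upwards [Metric.ball_mem_nhds (1 : ℝ) h2] with l hl x hx
  rw [mem_ball, Real.dist_eq, lt_min_iff, lt_div_iff₀ (by positivity)] at hl
  have h3 := h1 l hl.1 x hx
  have h4 : l • gradient v (l • x) - gradient v x =
      (l - 1) • gradient v (l • x) + (gradient v (l • x) - gradient v x) := by
    rw [sub_smul, one_smul]; abel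
  rw [h4]
  refine (norm_add_le _ _).trans ?_
  rw [norm_smul, Real.norm_eq_abs]
  nlinarith [norm_gradient_le hK (l • x), abs_nonneg (l - 1)]

lemma eventually_abs_dilQuot_le (h : IsStableModel n p R f v) {δ : ℝ} (hδ : 0 < δ) :
    ∀ᶠ l : ℝ in nhds 1, ∀ x ∈ ball (0 : Euc n) 1, ‖gradient v x‖ < δ / 2 →
      |dilQuot v l x| ≤ δ := by
  obtain ⟨τ, hτ, h1⟩ := h.exists_gradient_close (half_pos hδ)
  filter_upwards [Metric.ball_mem_nhds (1 : ℝ) hτ] with l hl x hx hg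
  have hx1 : ‖x‖ ≤ 1 := (mem_ball_zero_iff.1 hx).le
  rcases eq_or_ne l 1 with rfl | hne
  · simpa [dilQuot] using hδ.le
  have h2 := Convex.norm_image_sub_le_of_norm_hasDerivWithin_le (C := δ)
    (fun t _ => (hasDerivAt_comp_smul h.differentiable x t).hasDerivWithinAt)
    (fun t ht => ?_) (convex_ball (1 : ℝ) τ) (mem_ball_self hτ) hl
  · rw [one_smul, Real.norm_eq_abs, Real.norm_eq_abs] at h2
    rw [dilQuot, abs_mul, abs_inv, inv_mul_le_iff₀ (abs_pos.2 (sub_ne_zero.2 hne)), mul_comm]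
    exact h2
  · rw [mem_ball, Real.dist_eq] at ht
    have h3 := h1 t ht x hx
    have h4 : ‖gradient v (t • x)‖ ≤ δ := by
      have := norm_le_norm_add_norm_sub' (gradient v (t • x)) (gradient v x)
      linarith
    calc _ ≤ ‖x‖ * ‖gradient v (t • x)‖ := abs_real_inner_le_norm _ _
      _ ≤ 1 * δ := mul_le_mul hx1 h4 (norm_nonneg _) zero_le_one
      _ = δ := one_mul _

end IsStableModel

end Linearized

section TruncatedQuotient

variable {n : ℕ} {p R : ℝ} {f : ℝ → ℝ} {v : Euc n → ℝ}

/-- The truncation at level `δ` of the difference quotient of `v` under dilations. -/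
def truncQuot (v : Euc n → ℝ) (δ l : ℝ) (x : Euc n) : ℝ := softThr δ (dilQuot v l x)

lemma pHess_smul_self {E : Type*} [NormedAddCommGroup E] [InnerProductSpace ℝ E] (p t : ℝ)
    (a e : E) : pHess p a (t • e) (t • e) = t ^ 2 * pHess p a e e := by
  simp only [pHess, real_inner_smul_left, real_inner_smul_right]
  ring

lemma measurable_pHess {X Y : Euc n → Euc n} (hX : Measurable X) (hY : Measurable Y) :
    Measurable fun x => pHess p (X x) (Y x) (Y x) :=
  ((hX.norm.pow_const _).mul (hY.inner hY)).add
    ((measurable_const.mul (hX.norm.pow_const _)).mul ((hX.inner hY).mul (hX.inner hY)))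

/-- A bound for the second variation along fields which vanish where the gradient is small. -/
lemma abs_pHess_le_of_gradient {a y : Euc n} {m M L : ℝ} (hm : 0 < m) (ha : ‖a‖ ≤ M)
    (hy : ‖y‖ ≤ L) (h0 : ‖a‖ < m → y = 0) :
    |pHess p a y y| ≤ (1 + |p - 2|) * (max (m ^ (p - 2)) (M ^ (p - 2)) * L ^ 2) := by
  refine (abs_pHess_self_le p a y).trans (mul_le_mul_of_nonneg_left ?_ (by positivity))
  have hmax : 0 ≤ max (m ^ (p - 2)) (M ^ (p - 2)) :=
    (Real.rpow_nonneg hm.le _).trans (le_max_left _ _)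
  rcases lt_or_ge ‖a‖ m with h | h
  · rw [h0 h, norm_zero]
    simpa using mul_nonneg hmax (sq_nonneg L)
  · exact mul_le_mul (min_le_rpow_and_rpow_le_max (p - 2) hm h ha).2
      (pow_le_pow_left₀ (norm_nonneg _) hy 2) (by positivity) hmax

namespace IsStableModel

lemma exists_lipschitzWith_truncQuot (h : IsStableModel n p R f v) (δ l : ℝ) :
    ∃ K, LipschitzWith K (truncQuot v δ l) := by
  obtain ⟨K, hK⟩ := h.exists_lipschitzWith
  obtain ⟨K₁, hK₁⟩ := exists_lipschitzWith_dilQuot hK l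
  obtain ⟨K₂, hK₂⟩ := exists_lipschitzWith_softThr δ
  exact ⟨_, hK₂.comp hK₁⟩

lemma isTest_truncQuot_mul (h : IsStableModel n p R f v) (δ l : ℝ) {η : Euc n → ℝ}
    (hη : IsTest R η) : IsTest R fun x => truncQuot v δ l x * η x :=
  isTest_lipschitz_mul hη (h.exists_lipschitzWith_truncQuot δ l)

lemma abs_truncQuot_le {K : NNReal} (hK : LipschitzWith K v) (hR : R ≤ 1) {δ : ℝ} (hδ : 0 < δ)
    (l : ℝ) {x : Euc n} (hx : x ∈ ball (0 : Euc n) R) : |truncQuot v δ l x| ≤ K :=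
  (abs_softThr_le hδ _).trans (exists_bound_dilQuot hK hR l hx)

lemma eventually_truncQuot_eq_zero (h : IsStableModel n p R f v) {δ : ℝ} (hδ : 0 < δ) :
    ∀ᶠ l : ℝ in nhds 1, ∀ x ∈ ball (0 : Euc n) 1, ‖gradient v x‖ < δ / 2 →
      truncQuot v δ l x = 0 := by
  filter_upwards [h.eventually_abs_dilQuot_le hδ] with l hl x hx hg
  exact softThr_eq_zero (hl x hx hg)

lemma gradient_truncQuot_mul_eq_zero (h : IsStableModel n p R f v) (hR : R ≤ 1) {δ l : ℝ}
    (hl : ∀ x ∈ ball (0 : Euc n) 1, ‖gradient v x‖ < δ / 2 → truncQuot v δ l x = 0)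
    {η : Euc n → ℝ} (hη : IsTest R η) {x : Euc n} (hx : ‖gradient v x‖ < δ / 2) :
    gradient (fun y => truncQuot v δ l y * η y) x = 0 := by
  by_cases hxR : x ∈ ball (0 : Euc n) R
  · refine gradient_eq_zero_of_notMem_tsupport (notMem_tsupport_iff_eventuallyEq.2 ?_)
    have h1 := (continuous_gradient h.contDiff).norm.continuousAt.eventually (gt_mem_nhds hx)
    filter_upwards [h1, isOpen_ball.mem_nhds (ball_subset_ball hR hxR)] with y hy hy1
    rw [hl y hy1 hy, zero_mul, Pi.zero_apply]
  · exact (h.isTest_truncQuot_mul δ l hη).gradient_eq_zero hxR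

lemma eventually_ae_le_inner_quotient (h : IsStableModel n p R f v) (hp : 1 < p) (hR : R ≤ 1)
    {η : Euc n → ℝ} (hη : IsTest R η) {δ ε : ℝ} (hδ : 0 < δ) (hε : 0 < ε) :
    ∀ᶠ l : ℝ in nhdsWithin 1 {1}ᶜ, ∀ᵐ x,
      (1 - ε) * pHess p (gradient v x) (gradient (fun y => truncQuot v δ l y * η y) x)
          (gradient (fun y => truncQuot v δ l y * η y) x)
        - pHess p (gradient v x) (truncQuot v δ l x • gradient η x)
          (truncQuot v δ l x • gradient η x)
        - ε * (truncQuot v δ l x ^ 2 * ‖gradient η x‖ ^ 2) ≤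
      ⟪(l - 1)⁻¹ • (pFlux p (l • gradient v (l • x)) - pFlux p (gradient v x)),
        gradient (fun y => (truncQuot v δ l y * η y) * η y) x⟫ := by
  obtain ⟨K, hK⟩ := h.exists_lipschitzWith
  have hK0 : 0 ≤ (K : ℝ) := K.coe_nonneg
  set c := min 1 (p - 1) * min ((δ / 2) ^ (p - 2)) (((K : ℝ) + 1) ^ (p - 2)) with hc
  have hc0 : 0 < c := mul_pos (lt_min one_pos (by linarith))
    (lt_min (Real.rpow_pos_of_pos (by positivity) _) (Real.rpow_pos_of_pos (by positivity) _))
  have hε' : 0 < min (ε * c / 4) (ε / 5) := lt_min (by positivity) (by positivity)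
  obtain ⟨γ, hγ, hexp⟩ := exists_pFlux_expansion (E := Euc n) (M := (K : ℝ) + 1) p (half_pos hδ) hε'
  filter_upwards [(h.eventually_norm_smul_gradient_sub_le hγ).filter_mono nhdsWithin_le_nhds,
    (h.eventually_abs_dilQuot_le hδ).filter_mono nhdsWithin_le_nhds, self_mem_nhdsWithin]
    with l hl1 hl2 hl3
  have htest := h.isTest_truncQuot_mul δ l hη
  obtain ⟨Kg, hKg⟩ := h.exists_lipschitzWith_truncQuot δ l
  filter_upwards [hη.ae_differentiableAt, hKg.ae_differentiableAt] with x hηx hgx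
  by_cases hx : x ∈ ball (0 : Euc n) R
  swap
  · rw [htest.gradient_eq_zero hx, (hη.mul htest).gradient_eq_zero hx, hη.gradient_eq_zero hx]
    simp [pHess]
  have hx1 := ball_subset_ball hR hx
  have hw := hasGradientAt_dilQuot h.differentiable l x
  have hgrad1 := gradient_mul hgx hηx
  have hgrad2 : gradient (fun y => (truncQuot v δ l y * η y) * η y) x =
      (truncQuot v δ l x * η x) • gradient η x +
        η x • gradient (fun y => truncQuot v δ l y * η y) x := gradient_mul (hgx.mul hηx) hηx
  rw [hgrad2, hgrad1]
  rcases le_or_gt |dilQuot v l x| δ with hle | hgt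
  · have h1 : gradient (truncQuot v δ l) x = 0 :=
      gradient_softThr_of_le hδ hw.differentiableAt.continuousAt hle
    have h2 : truncQuot v δ l x = 0 := softThr_eq_zero hle
    simp [h1, h2, pHess]
  · have h1 : gradient (truncQuot v δ l) x =
        (l - 1)⁻¹ • (l • gradient v (l • x) - gradient v x) :=
      (gradient_softThr_of_lt hδ hw.differentiableAt hgt).trans hw.gradient
    have ha1 : δ / 2 ≤ ‖gradient v x‖ := by
      by_contra! hlt
      exact absurd (hl2 x hx1 hlt) (not_le.2 hgt)
    have ha2 : ‖gradient v x‖ ≤ (K : ℝ) + 1 := (norm_gradient_le hK x).trans (by linarith)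
    have hH : ∀ y, c * ‖y‖ ^ 2 ≤ pHess p (gradient v x) y y := fun y => by
      refine le_trans ?_ (le_pHess_self p _ y)
      rw [hc, mul_assoc]
      refine mul_le_mul_of_nonneg_left ?_ (le_min zero_le_one (by linarith))
      exact mul_le_mul_of_nonneg_right
        (min_le_rpow_and_rpow_le_max (p - 2) (half_pos hδ) ha1 ha2).1 (sq_nonneg _)
    have hd : ‖(l - 1)⁻¹ • (pFlux p (l • gradient v (l • x)) - pFlux p (gradient v x)) -
        pFluxDeriv p (gradient v x) ((l - 1)⁻¹ • (l • gradient v (l • x) - gradient v x))‖ ≤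
        min (ε * c / 4) (ε / 5) * ‖(l - 1)⁻¹ • (l • gradient v (l • x) - gradient v x)‖ := by
      rw [map_smul, ← smul_sub, norm_smul, norm_smul, mul_left_comm]
      exact mul_le_mul_of_nonneg_left (hexp _ _ ha1 ha2 (hl1 x hx1)) (norm_nonneg _)
    have key := le_inner_of_norm_sub_pFluxDeriv_le (s := η x) (g := truncQuot v δ l x)
      (e := gradient η x) hc0 hε'.le hH hd
    rw [h1, pHess_smul_self]
    set z := (l - 1)⁻¹ • (l • gradient v (l • x) - gradient v x)
    set g := truncQuot v δ l x
    have e1 : g • gradient η x + η x • z = η x • z + g • gradient η x := add_comm _ _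
    have e2 : (g * η x) • gradient η x + η x • (g • gradient η x + η x • z) =
        η x ^ 2 • z + (2 * (g * η x)) • gradient η x := by module
    rw [e2, e1]
    refine le_trans ?_ key
    have h3 : 4 * min (ε * c / 4) (ε / 5) / c ≤ ε := by
      rw [div_le_iff₀ hc0]; linarith [min_le_left (ε * c / 4) (ε / 5)]
    have h4 : 5 * min (ε * c / 4) (ε / 5) ≤ ε := by linarith [min_le_right (ε * c / 4) (ε / 5)]
    have h5 : 0 ≤ pHess p (gradient v x) (η x • z + g • gradient η x)
        (η x • z + g • gradient η x) := le_trans (by positivity) (hH _)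
    have h6 : 0 ≤ g ^ 2 * ‖gradient η x‖ ^ 2 := by positivity
    have h7 := mul_le_mul_of_nonneg_right h3 h5
    have h8 := mul_le_mul_of_nonneg_right h4 h6
    linarith

lemma integral_mul_sq_le_of_truncQuot (h : IsStableModel n p R f v) (hR : R ≤ 1) {δ l : ℝ}
    (hδ : 0 < δ)
    (hl : ∀ x ∈ ball (0 : Euc n) 1, ‖gradient v x‖ < δ / 2 → truncQuot v δ l x = 0)
    {η : Euc n → ℝ} (hη : IsTest R η) :
    ∫ x, deriv f (v x) * (truncQuot v δ l x * η x) ^ 2 ≤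
      ∫ x, pHess p (gradient v x) (gradient (fun y => truncQuot v δ l y * η y) x)
          (gradient (fun y => truncQuot v δ l y * η y) x) := by
  refine (h.stable _ (h.isTest_truncQuot_mul δ l hη)).trans_eq
    (setIntegral_eq_integral_of_forall_compl_eq_zero fun x hx => ?_)
  have hx0 : ‖gradient v x‖ < δ / 2 := by
    rw [mem_ofPred_eq, not_lt] at hx
    linarith
  rw [h.gradient_truncQuot_mul_eq_zero hR hl hη hx0]
  simp [pHess]

lemma integrable_inner_quotient (h : IsStableModel n p R f v) (hp : 1 < p) {ξ : Euc n → ℝ}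
    (hξ : IsTest R ξ) {l : ℝ} (hl : 0 < l) :
    Integrable fun x =>
      ⟪(l - 1)⁻¹ • (pFlux p (l • gradient v (l • x)) - pFlux p (gradient v x)),
        gradient ξ x⟫ := by
  obtain ⟨K, hK⟩ := h.exists_lipschitzWith
  have hK0 : 0 ≤ (K : ℝ) := K.coe_nonneg
  obtain ⟨L, hL⟩ := hξ.gradient_bounded
  have hmY : Measurable fun x => pFlux p (gradient v x) := measurable_pFlux_gradient
  have hYb := norm_pFlux_gradient_le (v := v) hp hK
  have hmYl : Measurable fun x => pFlux p (gradient v (l • x)) :=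
    hmY.comp (measurable_const_smul l)
  simp only [pFlux_smul hp hl.le]
  have hmD : Measurable fun x => (l - 1)⁻¹ • (l ^ (p - 1) • pFlux p (gradient v (l • x)) -
      pFlux p (gradient v x)) := by fun_prop
  refine integrable_of_bounded_of_ball (R := R)
    (C := |(l - 1)⁻¹| * (l ^ (p - 1) * (K : ℝ) ^ (p - 1) + (K : ℝ) ^ (p - 1)) * L)
    (hmD.inner (measurable_gradient _)).aestronglyMeasurable
    (fun x hx => by rw [hξ.gradient_eq_zero hx, inner_zero_right]) fun x _ => ?_
  refine (abs_real_inner_le_norm _ _).trans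
    (mul_le_mul ?_ (hL x) (norm_nonneg _) (by positivity))
  rw [norm_smul, Real.norm_eq_abs]
  refine mul_le_mul_of_nonneg_left ((norm_sub_le _ _).trans (add_le_add ?_ (hYb x)))
    (abs_nonneg _)
  rw [norm_smul, Real.norm_of_nonneg (by positivity)]
  exact mul_le_mul_of_nonneg_left (hYb _) (by positivity)

lemma eventually_truncated_inequality (h : IsStableModel n p R f v) (hp : 1 < p) (hR : R ≤ 1)
    {η : Euc n → ℝ} (hη : IsTest R η) {δ ε : ℝ} (hδ : 0 < δ) (hε : 0 < ε) (hε1 : ε ≤ 1) :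
    ∀ᶠ l : ℝ in nhdsWithin 1 (Iio 1),
      (1 - ε) * (∫ x, deriv f (v x) * (truncQuot v δ l x * η x) ^ 2)
        - (∫ x, pHess p (gradient v x) (truncQuot v δ l x • gradient η x)
          (truncQuot v δ l x • gradient η x))
        - ε * (∫ x, truncQuot v δ l x ^ 2 * ‖gradient η x‖ ^ 2) ≤
      ∫ x, (l - 1)⁻¹ * (l ^ p * f (v (l • x)) - f (v x)) * ((truncQuot v δ l x * η x) * η x) := by
  obtain ⟨K, hK⟩ := h.exists_lipschitzWith
  have hK0 : 0 ≤ (K : ℝ) := K.coe_nonneg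
  obtain ⟨L, hL⟩ := hη.gradient_bounded
  have hpos : ∀ᶠ l : ℝ in nhdsWithin 1 (Iio 1), 0 < l :=
    mem_nhdsWithin_of_mem_nhds (lt_mem_nhds one_pos)
  filter_upwards [(h.eventually_ae_le_inner_quotient hp hR hη hδ hε).filter_mono
    (nhdsWithin_mono _ fun l hl => ne_of_lt hl), hpos, self_mem_nhdsWithin,
    (h.eventually_truncQuot_eq_zero hδ).filter_mono nhdsWithin_le_nhds] with l hae hl0 hl1 hl
  have hl1' : l ≤ 1 := le_of_lt hl1
  have htest := h.isTest_truncQuot_mul δ l hη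
  have htest2 := hη.mul htest
  obtain ⟨Kg, hKg⟩ := h.exists_lipschitzWith_truncQuot δ l
  have hmg : Measurable (truncQuot v δ l) := hKg.continuous.measurable
  have hmv := measurable_gradient v
  have hme := measurable_gradient η
  obtain ⟨L₁, hL₁⟩ := htest.gradient_bounded
  have hS : Integrable fun x => pHess p (gradient v x)
      (gradient (fun y => truncQuot v δ l y * η y) x)
      (gradient (fun y => truncQuot v δ l y * η y) x) :=
    integrable_of_bounded_of_ball (R := R)
      (measurable_pHess hmv (measurable_gradient _)).aestronglyMeasurable
      (fun x hx => by rw [htest.gradient_eq_zero hx]; simp [pHess])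
      fun x _ => abs_pHess_le_of_gradient (half_pos hδ) (norm_gradient_le hK x) (hL₁ x)
        fun hx => h.gradient_truncQuot_mul_eq_zero hR hl hη hx
  have hgb : ∀ x ∈ ball (0 : Euc n) R, |truncQuot v δ l x| ≤ K := fun x hx =>
    abs_truncQuot_le hK hR hδ l hx
  have hT : Integrable fun x => pHess p (gradient v x) (truncQuot v δ l x • gradient η x)
      (truncQuot v δ l x • gradient η x) :=
    integrable_of_bounded_of_ball (R := R)
      (measurable_pHess hmv (hmg.smul hme)).aestronglyMeasurable
      (fun x hx => by rw [hη.gradient_eq_zero hx]; simp [pHess])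
      fun x hx => abs_pHess_le_of_gradient (L := K * L) (half_pos hδ) (norm_gradient_le hK x)
        (by
          rw [norm_smul, Real.norm_eq_abs]
          exact mul_le_mul (hgb x hx) (hL x) (norm_nonneg _) hK0)
        fun hx' => by rw [hl x (ball_subset_ball hR hx) hx', zero_smul]
  have hU : Integrable fun x => truncQuot v δ l x ^ 2 * ‖gradient η x‖ ^ 2 :=
    integrable_of_bounded_of_ball (R := R) (C := (K : ℝ) ^ 2 * L ^ 2)
      ((hmg.pow_const 2).mul (hme.norm.pow_const 2)).aestronglyMeasurable
      (fun x hx => by rw [hη.gradient_eq_zero hx]; simp)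
      fun x hx => by
        rw [abs_mul, abs_pow, abs_pow, abs_norm]
        exact mul_le_mul (pow_le_pow_left₀ (abs_nonneg _) (hgb x hx) 2)
          (pow_le_pow_left₀ (norm_nonneg _) (hL x) 2) (by positivity) (by positivity)
  have hI := h.integrable_inner_quotient hp htest2 hl0
  have hkey := integral_mono_ae (((hS.const_mul (1 - ε)).sub hT).sub (hU.const_mul ε)) hI hae
  have hS1 : Integrable fun x => (1 - ε) * pHess p (gradient v x)
      (gradient (fun y => truncQuot v δ l y * η y) x)
      (gradient (fun y => truncQuot v δ l y * η y) x) - pHess p (gradient v x)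
        (truncQuot v δ l x • gradient η x) (truncQuot v δ l x • gradient η x) :=
    (hS.const_mul (1 - ε)).sub hT
  rw [h.weak_eq_quotient hp htest2 hl0 hl1'] at hkey
  refine le_trans ?_ hkey
  simp only [Pi.sub_apply]
  rw [integral_sub hS1 (hU.const_mul ε), integral_sub (hS.const_mul (1 - ε)) hT,
    integral_const_mul, integral_const_mul]
  have := mul_le_mul_of_nonneg_left (h.integral_mul_sq_le_of_truncQuot hR hδ hl hη)
    (sub_nonneg.2 hε1)
  linarith

end IsStableModel

end TruncatedQuotient

section LinearizedInequality

variable {n : ℕ} {p R : ℝ} {f : ℝ → ℝ} {v : Euc n → ℝ}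

lemma measurable_softThr (δ : ℝ) : Measurable (softThr δ) := (continuous_softThr δ).measurable

lemma measurable_inner_gradient (v : Euc n → ℝ) : Measurable fun x => ⟪x, gradient v x⟫ :=
  measurable_id.inner (measurable_gradient v)

lemma abs_inner_gradient_le {K : NNReal} (hK : LipschitzWith K v) (hR : R ≤ 1) {x : Euc n}
    (hx : x ∈ ball (0 : Euc n) R) : |⟪x, gradient v x⟫| ≤ K := by
  have h1 : ‖x‖ ≤ 1 := (mem_ball_zero_iff.1 hx).le.trans hR
  calc _ ≤ ‖x‖ * ‖gradient v x‖ := abs_real_inner_le_norm _ _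
    _ ≤ 1 * K := mul_le_mul h1 (norm_gradient_le hK x) (norm_nonneg _) zero_le_one
    _ = K := one_mul _

lemma tendsto_softThr (w : ℝ) :
    Tendsto (fun δ => softThr δ w) (nhdsWithin 0 (Ioi 0)) (nhds w) := by
  rw [tendsto_iff_norm_sub_tendsto_zero]
  have h0 : Tendsto (fun δ : ℝ => δ) (nhdsWithin 0 (Ioi 0)) (nhds 0) :=
    tendsto_id.mono_left nhdsWithin_le_nhds
  refine tendsto_of_tendsto_of_tendsto_of_le_of_le' tendsto_const_nhds h0
    (Eventually.of_forall fun δ => norm_nonneg _) ?_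
  filter_upwards [self_mem_nhdsWithin] with δ hδ
  exact abs_softThr_sub_le hδ w

namespace IsStableModel

lemma hasDerivAt_rpow_mul_comp (h : IsStableModel n p R f v) (x : Euc n) {t : ℝ} (ht : 0 < t) :
    HasDerivAt (fun l : ℝ => l ^ p * f (v (l • x)))
      (p * t ^ (p - 1) * f (v (t • x)) +
        t ^ p * (deriv f (v (t • x)) * ⟪x, gradient v (t • x)⟫)) t := by
  have h1 : HasDerivAt (fun l : ℝ => l ^ p) (p * t ^ (p - 1)) t :=
    Real.hasDerivAt_rpow_const (Or.inl ht.ne')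
  have h2 : HasDerivAt f (deriv f (v (t • x))) (v (t • x)) :=
    (h.contDiff_right.differentiable one_ne_zero _).hasDerivAt
  exact h1.mul (h2.comp t (hasDerivAt_comp_smul h.differentiable x t))

lemma tendsto_quotient (h : IsStableModel n p R f v) (x : Euc n) :
    Tendsto (fun l : ℝ => (l - 1)⁻¹ * (l ^ p * f (v (l • x)) - f (v x))) (nhdsWithin 1 (Iio 1))
      (nhds (p * f (v x) + deriv f (v x) * ⟪x, gradient v x⟫)) := by
  have h1 := (h.hasDerivAt_rpow_mul_comp x one_pos).tendsto_slope.mono_left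
    (nhdsWithin_mono _ fun l (hl : l ∈ Iio 1) => ne_of_lt hl)
  simpa [slope_fun_def] using h1

lemma exists_bound_quotient (h : IsStableModel n p R f v) (hp : 1 < p) :
    ∃ C, ∀ l ∈ Ioo (0 : ℝ) 1, ∀ x ∈ ball (0 : Euc n) 1,
      |(l - 1)⁻¹ * (l ^ p * f (v (l • x)) - f (v x))| ≤ C := by
  obtain ⟨K, hK⟩ := h.exists_lipschitzWith
  obtain ⟨B, hB⟩ := h.exists_bound_comp h.contDiff_right.continuous
  obtain ⟨B', hB'⟩ := h.exists_bound_comp (h.contDiff_right.continuous_deriv le_rfl)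
  refine ⟨p * B + B' * K, fun l hl x hx => ?_⟩
  have hB0 : 0 ≤ B := (abs_nonneg _).trans (hB x)
  have hB0' : 0 ≤ B' := (abs_nonneg _).trans (hB' x)
  have h1 := Convex.norm_image_sub_le_of_norm_hasDerivWithin_le (C := p * B + B' * K)
    (s := Ioc (0 : ℝ) 1) (x := 1) (y := l)
    (fun t ht => (h.hasDerivAt_rpow_mul_comp x ht.1).hasDerivWithinAt)
    (fun t ht => ?_) (convex_Ioc 0 1) ⟨one_pos, le_rfl⟩ ⟨hl.1, hl.2.le⟩
  · rw [Real.one_rpow, one_smul, one_mul, Real.norm_eq_abs, Real.norm_eq_abs] at h1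
    rw [abs_mul, abs_inv, inv_mul_le_iff₀ (abs_pos.2 (sub_ne_zero.2 hl.2.ne)), mul_comm |l - 1|]
    exact h1
  · have ht0 : 0 ≤ t := ht.1.le
    have e1 : t ^ (p - 1) ≤ 1 := Real.rpow_le_one ht0 ht.2 (by linarith)
    have e2 : t ^ p ≤ 1 := Real.rpow_le_one ht0 ht.2 (by linarith)
    have e3 : |⟪x, gradient v (t • x)⟫| ≤ K := by
      calc _ ≤ ‖x‖ * ‖gradient v (t • x)‖ := abs_real_inner_le_norm _ _
        _ ≤ 1 * K := mul_le_mul (mem_ball_zero_iff.1 hx).le (norm_gradient_le hK _)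
          (norm_nonneg _) zero_le_one
        _ = K := one_mul _
    refine (norm_add_le _ _).trans (add_le_add ?_ ?_)
    · rw [Real.norm_eq_abs, abs_mul, abs_mul, abs_of_nonneg (by positivity : 0 ≤ t ^ (p - 1)),
        abs_of_pos (by linarith : 0 < p)]
      refine mul_le_mul (mul_le_of_le_one_right (by linarith) e1) (hB _) (abs_nonneg _)
        (by linarith)
    · rw [Real.norm_eq_abs, abs_mul, abs_mul, abs_of_nonneg (by positivity : 0 ≤ t ^ p)]
      calc _ ≤ 1 * (B' * K) := mul_le_mul e2 (mul_le_mul (hB' _) e3 (abs_nonneg _) hB0')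
            (by positivity) zero_le_one
        _ = _ := one_mul _

lemma tendsto_integral_deriv_mul_sq (h : IsStableModel n p R f v) {η : Euc n → ℝ}
    (hη : IsTest R η) {ι : Type*} {F : Filter ι} [F.IsCountablyGenerated]
    {G : ι → Euc n → ℝ} {w : Euc n → ℝ} {K : ℝ} (hK : 0 ≤ K) (hG : ∀ i, Measurable (G i))
    (hGb : ∀ᶠ i in F, ∀ x ∈ ball (0 : Euc n) R, |G i x| ≤ K)
    (hlim : ∀ x, Tendsto (fun i => G i x) F (nhds (w x))) :
    Tendsto (fun i => ∫ x, deriv f (v x) * (G i x * η x) ^ 2) F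
      (nhds (∫ x, deriv f (v x) * (w x * η x) ^ 2)) := by
  have hcf := h.contDiff_right.continuous_deriv le_rfl
  obtain ⟨B, hB⟩ := h.exists_bound_comp hcf
  obtain ⟨D, hD⟩ := hη.bounded
  have hmf : Measurable fun x => deriv f (v x) := (hcf.comp h.contDiff.continuous).measurable
  refine tendsto_integral_of_bounded_of_ball (C := B * (K * D) ^ 2) (R := R)
    (fun i => (hmf.mul (((hG i).mul hη.continuous.measurable).pow_const 2)).aestronglyMeasurable)
    (Eventually.of_forall fun i x hx => by rw [hη.eq_zero hx]; ring) ?_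
    (Eventually.of_forall fun x => (((hlim x).mul_const _).pow 2).const_mul _)
  filter_upwards [hGb] with i hi x hx
  have hD0 : 0 ≤ D := (abs_nonneg _).trans (hD x)
  rw [abs_mul, abs_pow, abs_mul]
  exact mul_le_mul (hB x) (pow_le_pow_left₀ (by positivity)
    (mul_le_mul (hi x hx) (hD x) (abs_nonneg _) hK) 2) (by positivity)
    ((abs_nonneg _).trans (hB x))

lemma linearized_truncated (h : IsStableModel n p R f v) (hp : 1 < p) (hR : R ≤ 1)
    {η : Euc n → ℝ} (hη : IsTest R η) {δ : ℝ} (hδ : 0 < δ) :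
    (∫ x, deriv f (v x) * (softThr δ ⟪x, gradient v x⟫ * η x) ^ 2)
        - (∫ x, softThr δ ⟪x, gradient v x⟫ ^ 2 *
          pHess p (gradient v x) (gradient η x) (gradient η x)) ≤
      ∫ x, (p * f (v x) + deriv f (v x) * ⟪x, gradient v x⟫) *
        ((softThr δ ⟪x, gradient v x⟫ * η x) * η x) := by
  obtain ⟨K, hK⟩ := h.exists_lipschitzWith
  have hK0 : 0 ≤ (K : ℝ) := K.coe_nonneg
  obtain ⟨L, hL⟩ := hη.gradient_bounded
  obtain ⟨D, hD⟩ := hη.bounded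
  have hmv := measurable_gradient v
  have hme := measurable_gradient η
  have hmη : Measurable η := hη.continuous.measurable
  have hle : nhdsWithin (1 : ℝ) (Iio 1) ≤ nhdsWithin 1 {1}ᶜ :=
    nhdsWithin_mono _ fun l hl => ne_of_lt hl
  have hmg : ∀ l, Measurable (truncQuot v δ l) := fun l =>
    (h.exists_lipschitzWith_truncQuot δ l).choose_spec.continuous.measurable
  have hgb : ∀ l, ∀ x ∈ ball (0 : Euc n) R, |truncQuot v δ l x| ≤ K := fun l x hx =>
    abs_truncQuot_le hK hR hδ l hx
  have hglim : ∀ x, Tendsto (fun l => truncQuot v δ l x) (nhdsWithin 1 (Iio 1))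
      (nhds (softThr δ ⟪x, gradient v x⟫)) := fun x =>
    ((continuous_softThr δ).tendsto _).comp ((tendsto_dilQuot h.differentiable x).mono_left hle)
  have hzero := (h.eventually_truncQuot_eq_zero hδ).filter_mono
    (nhdsWithin_le_nhds (s := Iio (1 : ℝ)))
  have hA := h.tendsto_integral_deriv_mul_sq hη hK0 hmg (Eventually.of_forall hgb) hglim
  have hT : Tendsto (fun l => ∫ x, pHess p (gradient v x) (truncQuot v δ l x • gradient η x)
      (truncQuot v δ l x • gradient η x)) (nhdsWithin 1 (Iio 1))
      (nhds (∫ x, softThr δ ⟪x, gradient v x⟫ ^ 2 *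
          pHess p (gradient v x) (gradient η x) (gradient η x))) := by
    refine tendsto_integral_of_bounded_of_ball (R := R)
      (C := (1 + |p - 2|) * (max ((δ / 2) ^ (p - 2)) ((K : ℝ) ^ (p - 2)) * (K * L) ^ 2))
      (fun l => (measurable_pHess hmv ((hmg l).smul hme)).aestronglyMeasurable)
      (Eventually.of_forall fun l x hx => by rw [hη.gradient_eq_zero hx]; simp [pHess]) ?_
      (Eventually.of_forall fun x => ?_)
    · filter_upwards [hzero] with l hl x hx
      refine abs_pHess_le_of_gradient (half_pos hδ) (norm_gradient_le hK x) ?_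
        fun hx' => by rw [hl x (ball_subset_ball hR hx) hx', zero_smul]
      rw [norm_smul, Real.norm_eq_abs]
      exact mul_le_mul (hgb l x hx) (hL x) (norm_nonneg _) hK0
    · simp only [pHess_smul_self]
      exact ((hglim x).pow 2).mul_const _
  have hU : Tendsto (fun l => ∫ x, truncQuot v δ l x ^ 2 * ‖gradient η x‖ ^ 2)
      (nhdsWithin 1 (Iio 1))
      (nhds (∫ x, softThr δ ⟪x, gradient v x⟫ ^ 2 * ‖gradient η x‖ ^ 2)) := by
    refine tendsto_integral_of_bounded_of_ball (R := R) (C := (K : ℝ) ^ 2 * L ^ 2)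
      (fun l => (((hmg l).pow_const 2).mul (hme.norm.pow_const 2)).aestronglyMeasurable)
      (Eventually.of_forall fun l x hx => by rw [hη.gradient_eq_zero hx]; simp)
      (Eventually.of_forall fun l x hx => ?_)
      (Eventually.of_forall fun x => ((hglim x).pow 2).mul_const _)
    rw [abs_mul, abs_pow, abs_pow, abs_norm]
    exact mul_le_mul (pow_le_pow_left₀ (abs_nonneg _) (hgb l x hx) 2)
      (pow_le_pow_left₀ (norm_nonneg _) (hL x) 2) (by positivity) (by positivity)
  have hI : Tendsto (fun l : ℝ => ∫ x, (l - 1)⁻¹ * (l ^ p * f (v (l • x)) - f (v x)) *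
      ((truncQuot v δ l x * η x) * η x)) (nhdsWithin 1 (Iio 1))
      (nhds (∫ x, (p * f (v x) + deriv f (v x) * ⟪x, gradient v x⟫) *
        ((softThr δ ⟪x, gradient v x⟫ * η x) * η x))) := by
    obtain ⟨C, hC⟩ := h.exists_bound_quotient hp
    have hmf : Measurable fun x => f (v x) :=
      (h.contDiff_right.continuous.comp h.contDiff.continuous).measurable
    have hmfl : ∀ l : ℝ, Measurable fun x => f (v (l • x)) := fun l =>
      hmf.comp (measurable_const_smul l)
    refine tendsto_integral_of_bounded_of_ball (R := R) (C := C * (K * D * D))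
      (fun l => ((((hmfl l).const_mul _).sub hmf).const_mul _ |>.mul
        (((hmg l).mul hmη).mul hmη)).aestronglyMeasurable)
      (Eventually.of_forall fun l x hx => by rw [hη.eq_zero hx]; ring) ?_
      (Eventually.of_forall fun x =>
        (h.tendsto_quotient x).mul (((hglim x).mul_const _).mul_const _))
    filter_upwards [mem_nhdsWithin_of_mem_nhds (lt_mem_nhds one_pos), self_mem_nhdsWithin]
      with l hl0 hl1 x hx
    have hD0 : 0 ≤ D := (abs_nonneg _).trans (hD x)
    have hC' := hC l ⟨hl0, hl1⟩ x (ball_subset_ball hR hx)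
    rw [abs_mul, abs_mul (truncQuot v δ l x * η x), abs_mul (truncQuot v δ l x)]
    exact mul_le_mul hC' (mul_le_mul (mul_le_mul (hgb l x hx) (hD x) (abs_nonneg _) hK0) (hD x)
      (abs_nonneg _) (by positivity)) (by positivity) ((abs_nonneg _).trans hC')
  set A := ∫ x, deriv f (v x) * (softThr δ ⟪x, gradient v x⟫ * η x) ^ 2
  set T := ∫ x, softThr δ ⟪x, gradient v x⟫ ^ 2 *
    pHess p (gradient v x) (gradient η x) (gradient η x)
  set U := ∫ x, softThr δ ⟪x, gradient v x⟫ ^ 2 * ‖gradient η x‖ ^ 2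
  set I := ∫ x, (p * f (v x) + deriv f (v x) * ⟪x, gradient v x⟫) *
    ((softThr δ ⟪x, gradient v x⟫ * η x) * η x)
  have hε : ∀ᶠ ε : ℝ in nhdsWithin 0 (Ioi 0), (1 - ε) * A - T - ε * U ≤ I := by
    filter_upwards [self_mem_nhdsWithin, mem_nhdsWithin_of_mem_nhds (gt_mem_nhds one_pos)]
      with ε hε0 hε1
    exact le_of_tendsto_of_tendsto (((hA.const_mul _).sub hT).sub (hU.const_mul _)) hI
      (h.eventually_truncated_inequality hp hR hη hδ hε0 (le_of_lt hε1))
  have hlim : Tendsto (fun ε : ℝ => (1 - ε) * A - T - ε * U) (nhdsWithin 0 (Ioi 0))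
      (nhds (A - T)) := by
    have hc : Continuous fun ε : ℝ => (1 - ε) * A - T - ε * U := by fun_prop
    have := hc.tendsto 0
    simp only [sub_zero, one_mul, zero_mul] at this
    exact this.mono_left nhdsWithin_le_nhds
  exact le_of_tendsto hlim hε

/-- The stability inequality tested with `⟪x, ∇v⟫ η`, after using the linearized equation. -/
lemma linearized_inequality (h : IsStableModel n p R f v) (hp : 1 < p) (hR : R ≤ 1)
    {η : Euc n → ℝ} (hη : IsTest R η) :
    -(∫ x, ⟪x, gradient v x⟫ ^ 2 * pHess p (gradient v x) (gradient η x) (gradient η x)) ≤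
      p * ∫ x, f (v x) * (⟪x, gradient v x⟫ * (η x * η x)) := by
  obtain ⟨K, hK⟩ := h.exists_lipschitzWith
  have hK0 : 0 ≤ (K : ℝ) := K.coe_nonneg
  obtain ⟨L, hL⟩ := hη.gradient_bounded
  obtain ⟨D, hD⟩ := hη.bounded
  have hcf := h.contDiff_right.continuous_deriv le_rfl
  obtain ⟨B, hB⟩ := h.exists_bound_comp h.contDiff_right.continuous
  obtain ⟨B', hB'⟩ := h.exists_bound_comp hcf
  have hmv := measurable_gradient v
  have hme := measurable_gradient η
  have hmη : Measurable η := hη.continuous.measurable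
  have hmf : Measurable fun x => f (v x) :=
    (h.contDiff_right.continuous.comp h.contDiff.continuous).measurable
  have hmf' : Measurable fun x => deriv f (v x) := (hcf.comp h.contDiff.continuous).measurable
  have hmw := measurable_inner_gradient v
  have hwb : ∀ x ∈ ball (0 : Euc n) R, |⟪x, gradient v x⟫| ≤ K := fun x hx =>
    abs_inner_gradient_le hK hR hx
  have hmT : ∀ δ : ℝ, Measurable fun x => softThr δ ⟪x, gradient v x⟫ := fun δ =>
    (measurable_softThr δ).comp hmw
  have hTb : ∀ᶠ δ : ℝ in nhdsWithin 0 (Ioi 0), ∀ x ∈ ball (0 : Euc n) R,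
      |softThr δ ⟪x, gradient v x⟫| ≤ K := by
    filter_upwards [self_mem_nhdsWithin] with δ hδ x hx
    exact (abs_softThr_le hδ _).trans (hwb x hx)
  have hA := h.tendsto_integral_deriv_mul_sq hη hK0 hmT hTb fun x => tendsto_softThr _
  have hT : Tendsto (fun δ => ∫ x, softThr δ ⟪x, gradient v x⟫ ^ 2 *
      pHess p (gradient v x) (gradient η x) (gradient η x)) (nhdsWithin 0 (Ioi 0))
      (nhds (∫ x, ⟪x, gradient v x⟫ ^ 2 *
        pHess p (gradient v x) (gradient η x) (gradient η x))) := by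
    refine tendsto_integral_of_bounded_of_ball (R := R)
      (C := (1 + |p - 2|) * ((K : ℝ) ^ p * L ^ 2))
      (fun δ => (((hmT δ).pow_const 2).mul (measurable_pHess hmv hme)).aestronglyMeasurable)
      (Eventually.of_forall fun δ x hx => by rw [hη.gradient_eq_zero hx]; simp [pHess]) ?_
      (Eventually.of_forall fun x => ((tendsto_softThr _).pow 2).mul_const _)
    filter_upwards [self_mem_nhdsWithin] with δ hδ x hx
    have hx1 : ‖x‖ ≤ 1 := (mem_ball_zero_iff.1 hx).le.trans hR
    have h1 : |softThr δ ⟪x, gradient v x⟫| ≤ ‖gradient v x‖ :=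
      (abs_softThr_le hδ _).trans ((abs_real_inner_le_norm _ _).trans
        (mul_le_of_le_one_left (norm_nonneg _) hx1))
    rw [abs_mul, abs_pow]
    calc _ ≤ ‖gradient v x‖ ^ 2 *
          ((1 + |p - 2|) * (‖gradient v x‖ ^ (p - 2) * ‖gradient η x‖ ^ 2)) :=
          mul_le_mul (pow_le_pow_left₀ (abs_nonneg _) h1 2) (abs_pHess_self_le p _ _)
            (abs_nonneg _) (by positivity)
      _ = (1 + |p - 2|) * (‖gradient v x‖ ^ p * ‖gradient η x‖ ^ 2) := by
          rw [← rpow_sub_two_mul_sq hp (norm_nonneg _)]; ring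
      _ ≤ _ := by
          refine mul_le_mul_of_nonneg_left (mul_le_mul (Real.rpow_le_rpow (norm_nonneg _)
            (norm_gradient_le hK x) (by linarith)) (pow_le_pow_left₀ (norm_nonneg _) (hL x) 2)
            (by positivity) (by positivity)) (by positivity)
  have hI : Tendsto (fun δ => ∫ x, (p * f (v x) + deriv f (v x) * ⟪x, gradient v x⟫) *
        ((softThr δ ⟪x, gradient v x⟫ * η x) * η x)) (nhdsWithin 0 (Ioi 0))
      (nhds (∫ x, (p * f (v x) + deriv f (v x) * ⟪x, gradient v x⟫) *
        ((⟪x, gradient v x⟫ * η x) * η x))) := by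
    refine tendsto_integral_of_bounded_of_ball (R := R) (C := (p * B + B' * K) * (K * D * D))
      (fun δ => (((hmf.const_mul p).add (hmf'.mul hmw)).mul
        (((hmT δ).mul hmη).mul hmη)).aestronglyMeasurable)
      (Eventually.of_forall fun δ x hx => by rw [hη.eq_zero hx]; ring) ?_
      (Eventually.of_forall fun x => (((tendsto_softThr _).mul_const _).mul_const _).const_mul _)
    filter_upwards [hTb] with δ hδ x hx
    have hD0 : 0 ≤ D := (abs_nonneg _).trans (hD x)
    have hB0' : 0 ≤ B' := (abs_nonneg _).trans (hB' x)
    have h1 : |p * f (v x) + deriv f (v x) * ⟪x, gradient v x⟫| ≤ p * B + B' * K := by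
      refine (abs_add_le _ _).trans ?_
      rw [abs_mul, abs_mul, abs_of_pos (by linarith : 0 < p)]
      exact add_le_add (mul_le_mul_of_nonneg_left (hB x) (by linarith))
        (mul_le_mul (hB' x) (hwb x hx) (abs_nonneg _) hB0')
    rw [abs_mul, abs_mul (softThr δ ⟪x, gradient v x⟫ * η x), abs_mul (softThr δ _)]
    exact mul_le_mul h1 (mul_le_mul (mul_le_mul (hδ x hx) (hD x) (abs_nonneg _) hK0) (hD x)
      (abs_nonneg _) (by positivity)) (by positivity) ((abs_nonneg _).trans h1)
  have hδ : ∀ᶠ δ : ℝ in nhdsWithin 0 (Ioi 0),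
      (∫ x, deriv f (v x) * (softThr δ ⟪x, gradient v x⟫ * η x) ^ 2)
        - (∫ x, softThr δ ⟪x, gradient v x⟫ ^ 2 *
          pHess p (gradient v x) (gradient η x) (gradient η x)) ≤
      ∫ x, (p * f (v x) + deriv f (v x) * ⟪x, gradient v x⟫) *
        ((softThr δ ⟪x, gradient v x⟫ * η x) * η x) := by
    filter_upwards [self_mem_nhdsWithin] with δ hδ
    exact h.linearized_truncated hp hR hη hδ
  have hfin := le_of_tendsto_of_tendsto (hA.sub hT) hI hδ
  have hI1 : Integrable fun x => f (v x) * (⟪x, gradient v x⟫ * (η x * η x)) := by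
    refine integrable_of_bounded_of_ball (R := R) (C := B * (K * (D * D)))
      (hmf.mul (hmw.mul (hmη.mul hmη))).aestronglyMeasurable
      (fun x hx => by rw [hη.eq_zero hx]; ring) fun x hx => ?_
    have hD0 : 0 ≤ D := (abs_nonneg _).trans (hD x)
    rw [abs_mul, abs_mul, abs_mul]
    exact mul_le_mul (hB x) (mul_le_mul (hwb x hx) (mul_le_mul (hD x) (hD x) (abs_nonneg _) hD0)
      (by positivity) hK0) (by positivity) ((abs_nonneg _).trans (hB x))
  have hI2 : Integrable fun x => deriv f (v x) * (⟪x, gradient v x⟫ * η x) ^ 2 := by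
    refine integrable_of_bounded_of_ball (R := R) (C := B' * (K * D) ^ 2)
      (hmf'.mul ((hmw.mul hmη).pow_const 2)).aestronglyMeasurable
      (fun x hx => by rw [hη.eq_zero hx]; ring) fun x hx => ?_
    have hD0 : 0 ≤ D := (abs_nonneg _).trans (hD x)
    rw [abs_mul, abs_pow, abs_mul]
    exact mul_le_mul (hB' x) (pow_le_pow_left₀ (by positivity)
      (mul_le_mul (hwb x hx) (hD x) (abs_nonneg _) hK0) 2) (by positivity)
      ((abs_nonneg _).trans (hB' x))
  have hsplit : ∫ x, (p * f (v x) + deriv f (v x) * ⟪x, gradient v x⟫) *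
        ((⟪x, gradient v x⟫ * η x) * η x) =
      p * (∫ x, f (v x) * (⟪x, gradient v x⟫ * (η x * η x))) +
        ∫ x, deriv f (v x) * (⟪x, gradient v x⟫ * η x) ^ 2 := by
    rw [← integral_const_mul, ← integral_add (hI1.const_mul p) hI2]
    refine integral_congr_ae (Eventually.of_forall fun x => ?_)
    ring
  rw [hsplit] at hfin
  linarith

end IsStableModel

end LinearizedInequality

section StabilityDensity

variable {n : ℕ} {p R : ℝ} {f : ℝ → ℝ} {v : Euc n → ℝ}

/-- The quadratic expression in `(s, e) = (φ, ∇φ)` controlling the annulus terms. -/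
def annulusDensity (x e : Euc n) (s : ℝ) : ℝ :=
  s ^ 2 + ‖x‖ * |s| * ‖e‖ + ‖x‖ ^ 2 * ‖e‖ ^ 2

lemma annulusDensity_nonneg (x e : Euc n) (s : ℝ) : 0 ≤ annulusDensity x e s := by
  unfold annulusDensity; positivity

/-- The integrand of the stability inequality at the point `x`, with `a = ∇u`, `e = ∇φ` and
`s = φ`. -/
def stabDensity (p : ℝ) (x a e : Euc n) (s : ℝ) : ℝ :=
  ‖a‖ ^ p * (2 * (⟪x, e⟫ * s)) - p * (⟪x, a⟫ * ‖a‖ ^ (p - 2) * (2 * (⟪a, e⟫ * s)))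
    + (n - p) * (‖a‖ ^ p * s ^ 2) - ⟪x, a⟫ ^ 2 * ‖a‖ ^ (p - 2) * ‖e‖ ^ 2
    - (p - 2) * (⟪x, a⟫ ^ 2 * ‖a‖ ^ (p - 4) * ⟪a, e⟫ ^ 2)

lemma abs_stabDensity_fst_le (x a e : Euc n) (s : ℝ) :
    |‖a‖ ^ p * (2 * (⟪x, e⟫ * s))| ≤ 2 * (‖a‖ ^ p * annulusDensity x e s) := by
  rw [abs_mul, abs_mul, abs_mul, abs_two, abs_of_nonneg (by positivity : 0 ≤ ‖a‖ ^ p)]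
  have h := mul_le_mul_of_nonneg_right (abs_real_inner_le_norm x e) (abs_nonneg s)
  have h' : |⟪x, e⟫| * |s| ≤ annulusDensity x e s := by
    unfold annulusDensity
    nlinarith [sq_nonneg s, sq_nonneg (‖x‖ * ‖e‖)]
  have := mul_le_mul_of_nonneg_left h' (by positivity : 0 ≤ ‖a‖ ^ p)
  linarith

lemma abs_stabDensity_snd_le (hp : 1 < p) (x a e : Euc n) (s : ℝ) :
    |⟪x, a⟫ * ‖a‖ ^ (p - 2) * (2 * (⟪a, e⟫ * s))| ≤ 2 * (‖a‖ ^ p * annulusDensity x e s) := by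
  rw [abs_mul, abs_mul, abs_mul, abs_mul, abs_two,
    abs_of_nonneg (by positivity : 0 ≤ ‖a‖ ^ (p - 2))]
  calc _ ≤ (‖x‖ * ‖a‖) * ‖a‖ ^ (p - 2) * (2 * ((‖a‖ * ‖e‖) * |s|)) := by
        gcongr <;> exact abs_real_inner_le_norm _ _
    _ = 2 * (‖a‖ ^ p * (‖x‖ * |s| * ‖e‖)) := by
        rw [← rpow_sub_two_mul_sq hp (norm_nonneg a)]; ring
    _ ≤ _ := by
        gcongr
        unfold annulusDensity
        nlinarith [sq_nonneg s, sq_nonneg (‖x‖ * ‖e‖)]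

lemma abs_stabDensity_thd_le (x a e : Euc n) (s : ℝ) :
    |‖a‖ ^ p * s ^ 2| ≤ ‖a‖ ^ p * annulusDensity x e s := by
  rw [abs_of_nonneg (by positivity)]
  gcongr
  unfold annulusDensity
  have : 0 ≤ ‖x‖ * |s| * ‖e‖ + ‖x‖ ^ 2 * ‖e‖ ^ 2 := by positivity
  linarith

lemma sq_inner_mul_le (hp : 1 < p) (x a e : Euc n) (s : ℝ) :
    ⟪x, a⟫ ^ 2 * (‖a‖ ^ (p - 2) * ‖e‖ ^ 2) ≤ ‖a‖ ^ p * annulusDensity x e s := by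
  have h : ⟪x, a⟫ ^ 2 ≤ (‖x‖ * ‖a‖) ^ 2 := by
    rw [← sq_abs]
    exact pow_le_pow_left₀ (abs_nonneg _) (abs_real_inner_le_norm x a) 2
  calc _ ≤ (‖x‖ * ‖a‖) ^ 2 * (‖a‖ ^ (p - 2) * ‖e‖ ^ 2) := by gcongr
    _ = ‖a‖ ^ p * (‖x‖ ^ 2 * ‖e‖ ^ 2) := by
        rw [← rpow_sub_two_mul_sq hp (norm_nonneg a)]; ring
    _ ≤ _ := by
        gcongr
        unfold annulusDensity
        have : 0 ≤ s ^ 2 + ‖x‖ * |s| * ‖e‖ := by positivity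
        linarith

lemma abs_stabDensity_fourth_le (hp : 1 < p) (x a e : Euc n) (s : ℝ) :
    |⟪x, a⟫ ^ 2 * ‖a‖ ^ (p - 2) * ‖e‖ ^ 2| ≤ ‖a‖ ^ p * annulusDensity x e s := by
  rw [abs_of_nonneg (by positivity), mul_assoc]
  exact sq_inner_mul_le hp x a e s

lemma abs_stabDensity_fifth_le (hp : 1 < p) (x a e : Euc n) (s : ℝ) :
    |⟪x, a⟫ ^ 2 * ‖a‖ ^ (p - 4) * ⟪a, e⟫ ^ 2| ≤ ‖a‖ ^ p * annulusDensity x e s := by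
  rw [abs_of_nonneg (by positivity), mul_assoc]
  exact (mul_le_mul_of_nonneg_left (rpow_sub_four_mul_sq_le a e) (sq_nonneg _)).trans
    (sq_inner_mul_le hp x a e s)

lemma abs_stabDensity_le (hp : 1 < p) (x a e : Euc n) (s : ℝ) :
    |stabDensity p x a e s| ≤
      (3 + 2 * p + |n - p| + |p - 2|) * (‖a‖ ^ p * annulusDensity x e s) := by
  have h1 := abs_stabDensity_fst_le (p := p) x a e s
  have h2 := mul_le_mul_of_nonneg_left (abs_stabDensity_snd_le hp x a e s) (abs_nonneg p)
  have h3 := mul_le_mul_of_nonneg_left (abs_stabDensity_thd_le (p := p) x a e s)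
    (abs_nonneg ((n : ℝ) - p))
  have h4 := abs_stabDensity_fourth_le hp x a e s
  have h5 := mul_le_mul_of_nonneg_left (abs_stabDensity_fifth_le hp x a e s) (abs_nonneg (p - 2))
  rw [← abs_mul] at h2 h3 h5
  rw [abs_of_pos (by linarith : 0 < p)] at h2
  unfold stabDensity
  refine (abs_sub _ _).trans ?_
  refine (add_le_add_left ((abs_sub _ _).trans (add_le_add_left ((abs_add_le _ _).trans
    (add_le_add_left (abs_sub _ _) _)) _)) _).trans ?_
  linarith

namespace IsStableModel

lemma integrable_of_le_annulusDensity (h : IsStableModel n p R f v) (hp : 1 < p) (hR : R ≤ 1)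
    {η : Euc n → ℝ} (hη : IsTest R η) {F : Euc n → ℝ} {c : ℝ} (hc : 0 ≤ c) (hF : Measurable F)
    (hb : ∀ x, |F x| ≤ c * (‖gradient v x‖ ^ p * annulusDensity x (gradient η x) (η x))) :
    Integrable F := by
  obtain ⟨K, hK⟩ := h.exists_lipschitzWith
  obtain ⟨L, hL⟩ := hη.gradient_bounded
  obtain ⟨D, hD⟩ := hη.bounded
  refine integrable_of_bounded_of_ball (R := R)
    (C := c * ((K : ℝ) ^ p * (D ^ 2 + 1 * D * L + 1 ^ 2 * L ^ 2))) hF.aestronglyMeasurable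
    (fun x hx => ?_) fun x hx => ?_
  · have := hb x
    rw [hη.eq_zero hx, hη.gradient_eq_zero hx] at this
    simpa [annulusDensity] using this
  · refine (hb x).trans ?_
    have hx1 : ‖x‖ ≤ 1 := (mem_ball_zero_iff.1 hx).le.trans hR
    have hD0 : 0 ≤ D := (abs_nonneg _).trans (hD x)
    have hL0 : 0 ≤ L := (norm_nonneg _).trans (hL x)
    have h1 := norm_gradient_le hK x
    have h2 := hD x
    have h3 := hL x
    unfold annulusDensity
    rw [← sq_abs (η x)]
    gcongr

/-- The stability inequality for radial test functions on the whole space. -/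
lemma integral_stabDensity_nonpos (h : IsStableModel n p R f v) (hp : 1 < p) (hR : R ≤ 1)
    {η : Euc n → ℝ} (hη : IsTest R η) :
    ∫ x, stabDensity p x (gradient v x) (gradient η x) (η x) ≤ 0 := by
  have hp0 : 0 < p := by linarith
  have hmv := measurable_gradient v
  have hme := measurable_gradient η
  have hmη : Measurable η := hη.continuous.measurable
  have hmw := measurable_inner_gradient v
  have hmxe := measurable_inner_gradient η
  have hmae : Measurable fun x => ⟪gradient v x, gradient η x⟫ := hmv.inner hme
  have hmp : ∀ q : ℝ, Measurable fun x => ‖gradient v x‖ ^ q := fun q => hmv.norm.pow_const q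
  have hI1 : Integrable fun x => ‖gradient v x‖ ^ p * (2 * (⟪x, gradient η x⟫ * η x)) :=
    h.integrable_of_le_annulusDensity hp hR hη zero_le_two
      ((hmp p).mul ((hmxe.mul hmη).const_mul 2)) fun x => abs_stabDensity_fst_le _ _ _ _
  have hI2 : Integrable fun x => ⟪x, gradient v x⟫ * ‖gradient v x‖ ^ (p - 2) *
      (2 * (⟪gradient v x, gradient η x⟫ * η x)) :=
    h.integrable_of_le_annulusDensity hp hR hη zero_le_two
      ((hmw.mul (hmp _)).mul ((hmae.mul hmη).const_mul 2)) fun x => abs_stabDensity_snd_le hp _ _ _ _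
  have hI3 : Integrable fun x => ‖gradient v x‖ ^ p * η x ^ 2 :=
    h.integrable_of_le_annulusDensity hp hR hη zero_le_one ((hmp p).mul (hmη.pow_const 2))
      fun x => (abs_stabDensity_thd_le _ _ _ _).trans_eq (one_mul _).symm
  have hI6 : Integrable fun x =>
      ⟪x, gradient v x⟫ ^ 2 * pHess p (gradient v x) (gradient η x) (gradient η x) := by
    refine h.integrable_of_le_annulusDensity hp hR hη (c := 1 + |p - 2|) (by positivity)
      ((hmw.pow_const 2).mul (measurable_pHess hmv hme)) fun x => ?_
    rw [abs_mul, abs_of_nonneg (sq_nonneg _)]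
    refine (mul_le_mul_of_nonneg_left (abs_pHess_self_le p _ _) (sq_nonneg _)).trans ?_
    rw [mul_left_comm]
    exact mul_le_mul_of_nonneg_left (sq_inner_mul_le hp _ _ _ _) (by positivity)
  have hlin := h.linearized_inequality hp hR hη
  have hpoh := h.pohozaev_le hp hR (hη.mul hη) fun x => mul_self_nonneg (η x)
  have hgrad : ∀ᵐ x, gradient (fun y => η y * η y) x = (2 * η x) • gradient η x := by
    filter_upwards [hη.ae_differentiableAt] with x hx
    exact gradient_mul_self hx
  have e1 : ∫ x, ⟪x, gradient v x⟫ *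
        ⟪pFlux p (gradient v x), gradient (fun y => η y * η y) x⟫ =
      ∫ x, ⟪x, gradient v x⟫ * ‖gradient v x‖ ^ (p - 2) *
        (2 * (⟪gradient v x, gradient η x⟫ * η x)) := by
    refine integral_congr_ae ?_
    filter_upwards [hgrad] with x hx
    rw [hx, pFlux, real_inner_smul_left, real_inner_smul_right]
    ring
  have e2 : ∫ x, ‖gradient v x‖ ^ p *
        ((p - n) * (η x * η x) - ⟪x, gradient (fun y => η y * η y) x⟫) =
      (p - n) * (∫ x, ‖gradient v x‖ ^ p * η x ^ 2) -
        ∫ x, ‖gradient v x‖ ^ p * (2 * (⟪x, gradient η x⟫ * η x)) := by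
    rw [← integral_const_mul, ← integral_sub (hI3.const_mul _) hI1]
    refine integral_congr_ae ?_
    filter_upwards [hgrad] with x hx
    rw [hx, real_inner_smul_right]
    ring
  have e3 : ∫ x, stabDensity p x (gradient v x) (gradient η x) (η x) =
      (∫ x, ‖gradient v x‖ ^ p * (2 * (⟪x, gradient η x⟫ * η x)))
        - p * (∫ x, ⟪x, gradient v x⟫ * ‖gradient v x‖ ^ (p - 2) *
          (2 * (⟪gradient v x, gradient η x⟫ * η x)))
        + (n - p) * (∫ x, ‖gradient v x‖ ^ p * η x ^ 2)
        - ∫ x, ⟪x, gradient v x⟫ ^ 2 * pHess p (gradient v x) (gradient η x) (gradient η x) := by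
    have hI12 : Integrable fun x => ‖gradient v x‖ ^ p * (2 * (⟪x, gradient η x⟫ * η x))
        - p * (⟪x, gradient v x⟫ * ‖gradient v x‖ ^ (p - 2) *
          (2 * (⟪gradient v x, gradient η x⟫ * η x))) := hI1.sub (hI2.const_mul p)
    have hI123 : Integrable fun x => ‖gradient v x‖ ^ p * (2 * (⟪x, gradient η x⟫ * η x))
        - p * (⟪x, gradient v x⟫ * ‖gradient v x‖ ^ (p - 2) *
          (2 * (⟪gradient v x, gradient η x⟫ * η x)))
        + (n - p) * (‖gradient v x‖ ^ p * η x ^ 2) := hI12.add (hI3.const_mul _)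
    rw [← integral_const_mul, ← integral_const_mul, ← integral_sub hI1 (hI2.const_mul p),
      ← integral_add hI12 (hI3.const_mul _), ← integral_sub hI123 hI6]
    refine integral_congr_ae (Eventually.of_forall fun x => ?_)
    simp only [stabDensity, pHess, real_inner_self_eq_norm_sq]
    ring
  rw [e1, e2] at hpoh
  have h1 := mul_le_mul_of_nonneg_left hpoh hp0.le
  rw [mul_add, mul_inv_cancel_left₀ hp0.ne'] at h1
  rw [e3]
  linarith

end IsStableModel

end StabilityDensity

section Localization

variable {n : ℕ} {p R : ℝ} {f : ℝ → ℝ}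

/-- A stable regular solution coincides on a smaller ball with a compactly supported model. -/
lemma exists_isStableModel {u : Euc n → ℝ} (hp : 1 < p) (hf : ContDiff ℝ 1 f)
    (hu : IsStableRegularSolution n p (ball 0 1) f u) (hR0 : 0 < R) (hR1 : R < 1) :
    ∃ v, IsStableModel n p R f v ∧ (∀ x ∈ ball (0 : Euc n) R, v x = u x) ∧
      ∀ x ∈ ball (0 : Euc n) R, gradient v x = gradient u x := by
  obtain ⟨⟨huC, -, hweak⟩, hstab⟩ := hu
  let χ : ContDiffBump (0 : Euc n) := ⟨R, (R + 1) / 2, hR0, by linarith⟩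
  set v : Euc n → ℝ := fun x => χ x * u x with hv
  have hveq : ∀ x ∈ ball (0 : Euc n) R, v x = u x := fun x hx => by
    rw [hv]
    simp only
    rw [χ.one_of_mem_closedBall (ball_subset_closedBall hx), one_mul]
  have hgeq : ∀ x ∈ ball (0 : Euc n) R, gradient v x = gradient u x := fun x hx =>
    Filter.EventuallyEq.gradient_eq (eventually_of_mem (isOpen_ball.mem_nhds hx) hveq)
  have hvC : ContDiff ℝ 1 v := by
    refine contDiff_iff_contDiffAt.2 fun x => ?_
    by_cases hx : x ∈ ball (0 : Euc n) 1
    · exact χ.contDiffAt.mul (huC.contDiffAt (isOpen_ball.mem_nhds hx))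
    · have hxs : x ∉ tsupport v := fun h => hx <| by
        have h1 : x ∈ tsupport χ := tsupport_mul_subset_left h
        rw [χ.tsupport_eq] at h1
        exact closedBall_subset_ball (by simp only [χ]; linarith) h1
      exact contDiffAt_const.congr_of_eventuallyEq (notMem_tsupport_iff_eventuallyEq.1 hxs)
  have hvS : HasCompactSupport v := χ.hasCompactSupport.mul_right
  have hsub : ball (0 : Euc n) R ⊆ ball 0 1 := ball_subset_ball hR1.le
  obtain ⟨K, hK⟩ := hvC.lipschitzWith_of_hasCompactSupport hvS one_ne_zero
  obtain ⟨B, hB⟩ := (hvS.isCompact_range hvC.continuous).exists_bound_of_continuousOn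
    hf.continuous.continuousOn
  refine ⟨v, ⟨hf, hvC, hvS, fun ξ hξ => ?_, fun ξ hξ => ?_⟩, hveq, hgeq⟩
  · refine weak_eq_of_isTest IsStableModel.measurable_pFlux_gradient
      (IsStableModel.norm_pFlux_gradient_le hp hK) (hf.continuous.comp hvC.continuous).measurable (fun x => hB _ (mem_range_self x))
      (fun ζ hζ hζS hζR => ?_) hξ
    have h1 := hweak ζ hζ hζS (hζR.trans hsub)
    have h0 : ∀ x ∉ ball (0 : Euc n) R, ζ x = 0 ∧ gradient ζ x = 0 := fun x hx =>
      ⟨image_eq_zero_of_notMem_tsupport fun h => hx (hζR h),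
        gradient_eq_zero_of_notMem_tsupport fun h => hx (hζR h)⟩
    have e1 : ∫ x, ⟪pFlux p (gradient v x), gradient ζ x⟫ =
        ∫ x in ball 0 1, ‖gradient u x‖ ^ (p - 2) * ⟪gradient u x, gradient ζ x⟫ := by
      refine (setIntegral_eq_integral_of_forall_compl_eq_zero (s := ball 0 1) fun x hx => by
        rw [(h0 x fun h => hx (hsub h)).2, inner_zero_right]).symm.trans
          (setIntegral_congr_fun measurableSet_ball fun x _ => ?_)
      by_cases hx : x ∈ ball (0 : Euc n) R
      · simp only [pFlux, real_inner_smul_left, hgeq x hx]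
      · simp only [(h0 x hx).2, inner_zero_right, mul_zero]
    have e2 : ∫ x, f (v x) * ζ x = ∫ x in ball 0 1, f (u x) * ζ x := by
      refine (setIntegral_eq_integral_of_forall_compl_eq_zero (s := ball 0 1) fun x hx => by
        rw [(h0 x fun h => hx (hsub h)).1, mul_zero]).symm.trans
          (setIntegral_congr_fun measurableSet_ball fun x _ => ?_)
      by_cases hx : x ∈ ball (0 : Euc n) R
      · simp only [hveq x hx]
      · simp only [(h0 x hx).1, mul_zero]
    exact e1.trans (h1.trans e2.symm)
  · have h1 := hstab ξ hξ.1 hξ.hasCompactSupport (hξ.2.trans hsub)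
    have hms : ∀ w : Euc n → ℝ, MeasurableSet {y | 0 < ‖gradient w y‖} := fun w =>
      measurableSet_lt measurable_const (measurable_gradient w).norm
    have e1 : ∫ x, deriv f (v x) * ξ x ^ 2 = ∫ x in ball 0 1, deriv f (u x) * ξ x ^ 2 := by
      rw [← setIntegral_eq_integral_of_forall_compl_eq_zero (s := ball 0 1) fun x hx => by
        rw [hξ.eq_zero fun h => hx (hsub h)]; ring]
      refine setIntegral_congr_fun measurableSet_ball fun x _ => ?_
      by_cases hx : x ∈ ball (0 : Euc n) R
      · simp only [hveq x hx]
      · simp only [hξ.eq_zero hx]; ring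
    have e2 : ∫ x in {y | 0 < ‖gradient v y‖},
          pHess p (gradient v x) (gradient ξ x) (gradient ξ x) =
        ∫ x in ball 0 1 ∩ {y | 0 < ‖gradient u y‖},
          (‖gradient u x‖ ^ (p - 2) * ‖gradient ξ x‖ ^ 2
            + (p - 2) * ‖gradient u x‖ ^ (p - 4) * ⟪gradient u x, gradient ξ x⟫ ^ 2) := by
      rw [← integral_indicator (hms v), ← integral_indicator (measurableSet_ball.inter (hms u))]
      refine integral_congr_ae (Eventually.of_forall fun x => ?_)
      by_cases hx : x ∈ ball (0 : Euc n) R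
      · by_cases hx0 : 0 < ‖gradient u x‖
        · rw [indicator_of_mem (by rw [mem_ofPred_eq, hgeq x hx]; exact hx0),
            indicator_of_mem (show x ∈ ball (0 : Euc n) 1 ∩ {y | 0 < ‖gradient u y‖} from
              ⟨hsub hx, hx0⟩), hgeq x hx, pHess, real_inner_self_eq_norm_sq]
          ring
        · rw [indicator_of_notMem (by rw [mem_ofPred_eq, hgeq x hx]; exact hx0),
            indicator_of_notMem fun h => hx0 h.2]
      · simp only [indicator, hξ.gradient_eq_zero hx, pHess]
        simp
    rw [e1, e2]
    linarith

/-- The radial cutoff which is `1` on the ball of radius `ρ` and `0` outside the ball of radius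
`3ρ/2`. -/
def radialCutoff (ρ : ℝ) (x : Euc n) : ℝ := max 0 (min 1 (3 - 2 / ρ * ‖x‖))

lemma radialCutoff_nonneg (ρ : ℝ) (x : Euc n) : 0 ≤ radialCutoff ρ x := le_max_left _ _

lemma radialCutoff_le_one (ρ : ℝ) (x : Euc n) : radialCutoff ρ x ≤ 1 :=
  max_le zero_le_one (min_le_left _ _)

lemma radialCutoff_eq_one {ρ : ℝ} (hρ : 0 < ρ) {x : Euc n} (hx : x ∈ ball (0 : Euc n) ρ) :
    radialCutoff ρ x = 1 := by
  have h1 : 2 / ρ * ‖x‖ ≤ 2 := by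
    rw [div_mul_eq_mul_div, div_le_iff₀ hρ]
    linarith [mem_ball_zero_iff.1 hx]
  rw [radialCutoff, min_eq_left (by linarith), max_eq_right zero_le_one]

lemma radialCutoff_eq_zero {ρ : ℝ} (hρ : 0 < ρ) {x : Euc n}
    (hx : x ∉ ball (0 : Euc n) (3 * ρ / 2)) : radialCutoff ρ x = 0 := by
  rw [mem_ball_zero_iff, not_lt] at hx
  have h1 : 3 ≤ 2 / ρ * ‖x‖ := by
    rw [div_mul_eq_mul_div, le_div_iff₀ hρ]
    linarith
  rw [radialCutoff, max_eq_left]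
  exact (min_le_right _ _).trans (by linarith)

lemma lipschitzWith_radialCutoff {ρ : ℝ} (hρ : 0 < ρ) :
    LipschitzWith (Real.toNNReal (2 / ρ)) (radialCutoff (n := n) ρ) := by
  refine LipschitzWith.const_max (LipschitzWith.const_min
    (LipschitzWith.of_dist_le' fun x y => ?_) 1) 0
  rw [Real.dist_eq, sub_sub_sub_cancel_left, ← mul_sub, abs_mul, abs_of_pos (by positivity),
    abs_sub_comm]
  exact mul_le_mul_of_nonneg_left (abs_norm_sub_norm_le x y |>.trans_eq (dist_eq_norm x y).symm)
    (by positivity)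

lemma norm_gradient_radialCutoff_le {ρ : ℝ} (hρ : 0 < ρ) (x : Euc n) :
    ‖gradient (radialCutoff ρ) x‖ ≤ 2 / ρ := by
  refine (norm_gradient_le (lipschitzWith_radialCutoff hρ) x).trans_eq ?_
  exact Real.coe_toNNReal _ (by positivity)

lemma gradient_radialCutoff_eq_zero {ρ : ℝ} (hρ : 0 < ρ) {x : Euc n}
    (hx : x ∉ ball (0 : Euc n) (3 * ρ / 2)) : gradient (radialCutoff ρ) x = 0 := by
  have h1 : IsLocalMin (radialCutoff ρ) x := Eventually.of_forall fun y => by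
    rw [radialCutoff_eq_zero hρ hx]
    exact radialCutoff_nonneg ρ y
  rw [gradient, h1.fderiv_eq_zero, map_zero]

lemma isTest_radialCutoff {ρ : ℝ} (hρ : 0 < ρ) (hR : 3 * ρ / 2 < R) :
    IsTest R (radialCutoff (n := n) ρ) := by
  refine ⟨⟨_, lipschitzWith_radialCutoff hρ⟩, ?_⟩
  refine (closure_minimal (fun x hx => ?_) isClosed_closedBall).trans (closedBall_subset_ball hR)
  by_contra h
  exact hx (radialCutoff_eq_zero hρ fun h' => h (ball_subset_closedBall h'))

end Localization

section AnnulusEstimate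

variable {n : ℕ} {p R : ℝ} {f : ℝ → ℝ} {v : Euc n → ℝ}

lemma norm_mul_radialDeriv (w : Euc n → ℝ) (x : Euc n) :
    ‖x‖ * radialDeriv w x = ⟪x, gradient w x⟫ := by
  rcases eq_or_ne x 0 with rfl | hx
  · simp
  · exact mul_div_cancel₀ _ (norm_ne_zero_iff.2 hx)

lemma annulusDensity_mul_le {x k e : Euc n} {s c : ℝ} (hk : ‖x‖ * ‖k‖ ≤ 3) (hc : |c| ≤ 1) :
    annulusDensity x (s • k + c • e) (s * c) ≤ 13 * annulusDensity x e s := by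
  have h1 : |s * c| ≤ |s| := by
    rw [abs_mul]; exact mul_le_of_le_one_right (abs_nonneg s) hc
  have h2 : ‖x‖ * ‖s • k + c • e‖ ≤ 3 * |s| + ‖x‖ * ‖e‖ := by
    calc ‖x‖ * ‖s • k + c • e‖ ≤ ‖x‖ * (|s| * ‖k‖ + |c| * ‖e‖) := by
          gcongr
          refine (norm_add_le _ _).trans_eq ?_
          rw [norm_smul, norm_smul, Real.norm_eq_abs, Real.norm_eq_abs]
      _ = |s| * (‖x‖ * ‖k‖) + |c| * (‖x‖ * ‖e‖) := by ring
      _ ≤ |s| * 3 + 1 * (‖x‖ * ‖e‖) := by gcongr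
      _ = _ := by ring
  have hA := abs_nonneg s
  have hB : 0 ≤ ‖x‖ * ‖e‖ := by positivity
  calc annulusDensity x (s • k + c • e) (s * c)
      = |s * c| ^ 2 + |s * c| * (‖x‖ * ‖s • k + c • e‖) + (‖x‖ * ‖s • k + c • e‖) ^ 2 := by
        rw [annulusDensity, sq_abs]; ring
    _ ≤ |s| ^ 2 + |s| * (3 * |s| + ‖x‖ * ‖e‖) + (3 * |s| + ‖x‖ * ‖e‖) ^ 2 := by gcongr
    _ ≤ 13 * (|s| ^ 2 + |s| * (‖x‖ * ‖e‖) + (‖x‖ * ‖e‖) ^ 2) := by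
        nlinarith [mul_nonneg hA hB, sq_nonneg (‖x‖ * ‖e‖)]
    _ = 13 * annulusDensity x e s := by
        rw [annulusDensity, sq_abs]; ring

namespace IsStableModel

lemma integrableOn_annulusDensity (h : IsStableModel n p R f v) (hp : 1 < p) {g : Euc n → ℝ}
    {L : NNReal} (hg : LipschitzWith L g) (r : ℝ) :
    IntegrableOn (fun x => ‖gradient v x‖ ^ p * annulusDensity x (gradient g x) (g x))
      (ball 0 r) := by
  obtain ⟨K, hK⟩ := h.exists_lipschitzWith
  obtain ⟨D, hD⟩ := (isCompact_closedBall (0 : Euc n) r).exists_bound_of_continuousOn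
    hg.continuous.continuousOn
  have hmg := measurable_gradient g
  have hmm : Measurable fun x =>
      ‖gradient v x‖ ^ p * annulusDensity x (gradient g x) (g x) := by
    have hgm := hg.continuous.measurable
    unfold annulusDensity
    exact ((measurable_gradient v).norm.pow_const p).mul
      (((hgm.pow_const 2).add ((measurable_norm.mul hgm.abs).mul hmg.norm)).add
        ((measurable_norm.pow_const 2).mul (hmg.norm.pow_const 2)))
  refine Measure.integrableOn_of_bounded measure_ball_lt_top.ne hmm.aestronglyMeasurable
    (M := (K : ℝ) ^ p * (D ^ 2 + r * D * L + r ^ 2 * (L : ℝ) ^ 2)) ?_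
  refine (ae_restrict_mem measurableSet_ball).mono fun x hx => ?_
  have hx1 : ‖x‖ ≤ r := (mem_ball_zero_iff.1 hx).le
  have hr : 0 ≤ r := (norm_nonneg x).trans hx1
  have h1 := norm_gradient_le hK x
  have h2 : |g x| ≤ D := hD x (ball_subset_closedBall hx)
  have hD0 : 0 ≤ D := (abs_nonneg _).trans h2
  have h3 := norm_gradient_le hg x
  rw [Real.norm_of_nonneg (mul_nonneg (by positivity) (annulusDensity_nonneg _ _ _))]
  unfold annulusDensity
  rw [← sq_abs (g x)]
  gcongr

lemma measurable_stabDensity {v η : Euc n → ℝ} (hη : Measurable η) :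
    Measurable fun x => stabDensity p x (gradient v x) (gradient η x) (η x) := by
  have hmv := measurable_gradient v
  have hme := measurable_gradient η
  have hmw := measurable_inner_gradient v
  have hmxe := measurable_inner_gradient η
  have hmae : Measurable fun x => ⟪gradient v x, gradient η x⟫ := hmv.inner hme
  have hmp : ∀ q : ℝ, Measurable fun x => ‖gradient v x‖ ^ q := fun q => hmv.norm.pow_const q
  unfold stabDensity
  fun_prop

/-- Splitting the integral of the stability density into its five terms. -/
lemma setIntegral_stabDensity (h : IsStableModel n p R f v) (hp : 1 < p) (hR : R ≤ 1)
    {η : Euc n → ℝ} (hη : IsTest R η) (S : Set (Euc n)) :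
    ∫ x in S, stabDensity p x (gradient v x) (gradient η x) (η x) =
      (∫ x in S, ‖gradient v x‖ ^ p * (2 * (⟪x, gradient η x⟫ * η x)))
      - p * (∫ x in S, ⟪x, gradient v x⟫ * ‖gradient v x‖ ^ (p - 2) *
          (2 * (⟪gradient v x, gradient η x⟫ * η x)))
      + (n - p) * (∫ x in S, ‖gradient v x‖ ^ p * η x ^ 2)
      - (∫ x in S, ⟪x, gradient v x⟫ ^ 2 * ‖gradient v x‖ ^ (p - 2) * ‖gradient η x‖ ^ 2)
      - (p - 2) * (∫ x in S, ⟪x, gradient v x⟫ ^ 2 * ‖gradient v x‖ ^ (p - 4) *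
          ⟪gradient v x, gradient η x⟫ ^ 2) := by
  have hmv := measurable_gradient v
  have hme := measurable_gradient η
  have hmη : Measurable η := hη.continuous.measurable
  have hmw := measurable_inner_gradient v
  have hmxe := measurable_inner_gradient η
  have hmae : Measurable fun x => ⟪gradient v x, gradient η x⟫ := hmv.inner hme
  have hmp : ∀ q : ℝ, Measurable fun x => ‖gradient v x‖ ^ q := fun q => hmv.norm.pow_const q
  have hI1 := (h.integrable_of_le_annulusDensity hp hR hη zero_le_two
    ((hmp p).mul ((hmxe.mul hmη).const_mul 2))
    fun x => abs_stabDensity_fst_le _ _ _ _).integrableOn (s := S)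
  have hI2 := (h.integrable_of_le_annulusDensity hp hR hη zero_le_two
    ((hmw.mul (hmp _)).mul ((hmae.mul hmη).const_mul 2))
    fun x => abs_stabDensity_snd_le hp _ _ _ _).integrableOn (s := S)
  have hI3 := (h.integrable_of_le_annulusDensity hp hR hη zero_le_one
    ((hmp p).mul (hmη.pow_const 2))
    fun x => (abs_stabDensity_thd_le _ _ _ _).trans_eq (one_mul _).symm).integrableOn (s := S)
  have hI4 := (h.integrable_of_le_annulusDensity hp hR hη zero_le_one
    (((hmw.pow_const 2).mul (hmp _)).mul (hme.norm.pow_const 2))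
    fun x => (abs_stabDensity_fourth_le hp _ _ _ _).trans_eq (one_mul _).symm).integrableOn
    (s := S)
  have hI5 := (h.integrable_of_le_annulusDensity hp hR hη zero_le_one
    (((hmw.pow_const 2).mul (hmp _)).mul (hmae.pow_const 2))
    fun x => (abs_stabDensity_fifth_le hp _ _ _ _).trans_eq (one_mul _).symm).integrableOn
    (s := S)
  have hI12 := hI1.sub (hI2.const_mul p)
  have hI123 := hI12.add (hI3.const_mul ((n : ℝ) - p))
  have hI1234 := hI123.sub hI4
  have e := integral_sub hI1234 (hI5.const_mul (p - 2))
  have e' := integral_sub hI123 hI4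
  have e'' := integral_add hI12 (hI3.const_mul ((n : ℝ) - p))
  have e''' := integral_sub hI1 (hI2.const_mul p)
  simp only [Pi.sub_apply, Pi.add_apply, Pi.mul_apply, integral_const_mul] at e e' e'' e'''
  unfold stabDensity
  rw [← e''', ← e'', ← e', ← e]

end IsStableModel

end AnnulusEstimate

section MainEstimate

variable {n : ℕ} {p R : ℝ} {f : ℝ → ℝ} {v : Euc n → ℝ}

lemma IsStableModel.setIntegral_stabDensity_le (h : IsStableModel n p R f v) (hp : 1 < p)
    (hR : R ≤ 1) {ρ : ℝ} (hρ : 0 < ρ) (hρR : 3 * ρ / 2 < R) {g : Euc n → ℝ} {L : NNReal}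
    (hg : LipschitzWith L g) :
    ∃ η, IsTest R η ∧ (∀ x ∈ ball (0 : Euc n) ρ, η x = g x) ∧
      ∫ x in ball (0 : Euc n) ρ, stabDensity p x (gradient v x) (gradient η x) (η x) ≤
        13 * (3 + 2 * p + |n - p| + |p - 2|) *
          ∫ x in ball (0 : Euc n) (3 * ρ / 2) \ ball (0 : Euc n) ρ,
            ‖gradient v x‖ ^ p * annulusDensity x (gradient g x) (g x) := by
  have hχ := isTest_radialCutoff (n := n) hρ hρR
  have hη : IsTest R fun x => g x * radialCutoff ρ x :=
    IsStableModel.isTest_lipschitz_mul hχ ⟨L, hg⟩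
  refine ⟨_, hη, fun x hx => by rw [radialCutoff_eq_one hρ hx, mul_one], ?_⟩
  set η : Euc n → ℝ := fun x => g x * radialCutoff ρ x with hη_def
  set D : Euc n → ℝ := fun x => stabDensity p x (gradient v x) (gradient η x) (η x) with hD
  have hgrad : ∀ᵐ x, gradient η x = g x • gradient (radialCutoff ρ) x
      + radialCutoff ρ x • gradient g x := by
    filter_upwards [hg.ae_differentiableAt, hχ.ae_differentiableAt] with x h1 h2
    exact gradient_mul h1 h2
  have hc0 : 0 ≤ 3 + 2 * p + |n - p| + |p - 2| := by positivity
  have hDi : Integrable D := h.integrable_of_le_annulusDensity hp hR hη hc0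
    (measurable_stabDensity hη.continuous.measurable) fun x => abs_stabDensity_le hp _ _ _ _
  have hsub : ball (0 : Euc n) ρ ⊆ ball 0 (3 * ρ / 2) := ball_subset_ball (by linarith)
  have hout : ∫ x in (ball (0 : Euc n) (3 * ρ / 2))ᶜ, D x = 0 := by
    refine setIntegral_eq_zero_of_ae_eq_zero ?_
    filter_upwards [hgrad] with x hx hxc
    have h1 : η x = 0 := by rw [hη_def]; simp only; rw [radialCutoff_eq_zero hρ hxc, mul_zero]
    rw [hD]
    simp only
    rw [hx, h1, gradient_radialCutoff_eq_zero hρ hxc, radialCutoff_eq_zero hρ hxc]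
    simp [stabDensity]
  have htot := h.integral_stabDensity_nonpos hp hR hη
  rw [← integral_add_compl measurableSet_ball hDi, hout, add_zero,
    ← integral_inter_add_sdiff measurableSet_ball hDi.integrableOn,
    inter_eq_self_of_subset_right hsub] at htot
  have hann : -∫ x in ball (0 : Euc n) (3 * ρ / 2) \ ball (0 : Euc n) ρ, D x ≤
      13 * (3 + 2 * p + |n - p| + |p - 2|) *
        ∫ x in ball (0 : Euc n) (3 * ρ / 2) \ ball (0 : Euc n) ρ,
          ‖gradient v x‖ ^ p * annulusDensity x (gradient g x) (g x) := by
    rw [← integral_neg, ← integral_const_mul]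
    refine setIntegral_mono_on_ae hDi.integrableOn.neg
      (((h.integrableOn_annulusDensity hp hg _).mono_set sdiff_subset).const_mul _)
      (measurableSet_ball.diff measurableSet_ball) ?_
    filter_upwards [hgrad] with x hx hxA
    have hk : ‖x‖ * ‖gradient (radialCutoff ρ) x‖ ≤ 3 := by
      have h1 := (mem_ball_zero_iff.1 hxA.1).le
      calc _ ≤ 3 * ρ / 2 * (2 / ρ) := by
            gcongr
            exact norm_gradient_radialCutoff_le hρ x
        _ = 3 := by field_simp
    have hc : |radialCutoff ρ x| ≤ 1 := by
      rw [abs_of_nonneg (radialCutoff_nonneg ρ x)]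
      exact radialCutoff_le_one ρ x
    calc -D x ≤ |D x| := neg_le_abs _
      _ ≤ (3 + 2 * p + |n - p| + |p - 2|) *
            (‖gradient v x‖ ^ p * annulusDensity x (gradient η x) (η x)) :=
          abs_stabDensity_le hp _ _ _ _
      _ ≤ (3 + 2 * p + |n - p| + |p - 2|) *
            (‖gradient v x‖ ^ p * (13 * annulusDensity x (gradient g x) (g x))) := by
          gcongr
          rw [hx]
          exact annulusDensity_mul_le hk hc
      _ = _ := by ring
  linarith

end MainEstimate

/-- Lemma 2.5: for a stable regular solution `u` of `−Δ_p u = f(u)` in `B₁`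
and any Lipschitz function `φ` on `B₁`, for every `ρ ∈ (0, 2/3)`,
`∫_{B_ρ} 2|∇u|^p r φ_r φ − p ∫_{B_ρ} r u_r |∇u|^{p−2} ∇u·∇(φ²) + (n−p) ∫_{B_ρ} |∇u|^p φ²
  − ∫_{B_ρ} r² u_r² |∇u|^{p−2} |∇φ|² − (p−2) ∫_{B_ρ} r² u_r² |∇u|^{p−4} (∇u·∇φ)²
  ≤ C ∫_{B_{3ρ/2}∖B_ρ} |∇u|^p (φ² + r|φ||∇φ| + r²|∇φ|²)`,
where `C` depends only on `n` and `p`. -/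
theorem statement3 (n : ℕ) (p : ℝ) (hp : 1 < p) :
    ∃ C : ℝ, 0 < C ∧
      ∀ (f : ℝ → ℝ) (u : Euc n → ℝ) (φ : Euc n → ℝ), ContDiff ℝ 1 f →
        IsStableRegularSolution n p (ball 0 1) f u →
        (∃ K, LipschitzOnWith K φ (ball (0 : Euc n) 1)) →
        ∀ ρ ∈ Ioo (0 : ℝ) (2 / 3),
          (∫ x in ball (0 : Euc n) ρ,
              2 * ‖gradient u x‖ ^ p * ‖x‖ * radialDeriv φ x * φ x)
            - p * (∫ x in ball (0 : Euc n) ρ,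
                ‖x‖ * radialDeriv u x * ‖gradient u x‖ ^ (p - 2) *
                  ⟪gradient u x, gradient (fun y => φ y ^ 2) x⟫)
            + (n - p) * (∫ x in ball (0 : Euc n) ρ, ‖gradient u x‖ ^ p * φ x ^ 2)
            - (∫ x in ball (0 : Euc n) ρ,
                ‖x‖ ^ 2 * radialDeriv u x ^ 2 * ‖gradient u x‖ ^ (p - 2) *
                  ‖gradient φ x‖ ^ 2)
            - (p - 2) * (∫ x in ball (0 : Euc n) ρ,
                ‖x‖ ^ 2 * radialDeriv u x ^ 2 * ‖gradient u x‖ ^ (p - 4) *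
                  ⟪gradient u x, gradient φ x⟫ ^ 2)
          ≤ C * ∫ x in ball (0 : Euc n) (3 * ρ / 2) \ ball (0 : Euc n) ρ,
              ‖gradient u x‖ ^ p *
                (φ x ^ 2 + ‖x‖ * |φ x| * ‖gradient φ x‖ + ‖x‖ ^ 2 * ‖gradient φ x‖ ^ 2) := by
  refine ⟨13 * (3 + 2 * p + |n - p| + |p - 2|), by positivity, ?_⟩
  rintro f u φ hf hu ⟨K, hφ⟩ ρ ⟨hρ, hρ'⟩
  obtain ⟨g, hg, hgφ⟩ := hφ.extend_real
  obtain ⟨v, hv, -, hgv⟩ := exists_isStableModel (R := (3 * ρ / 2 + 1) / 2) hp hf hu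
    (by linarith) (by linarith)
  have hR1 : (3 * ρ / 2 + 1) / 2 ≤ 1 := by linarith
  obtain ⟨η, hη, hηg, hle⟩ := hv.setIntegral_stabDensity_le hp hR1 hρ (by linarith) hg
  have hgradg : ∀ x ∈ ball (0 : Euc n) 1, gradient g x = gradient φ x := fun x hx =>
    Filter.EventuallyEq.gradient_eq
      (eventually_of_mem (isOpen_ball.mem_nhds hx) fun y hy => (hgφ hy).symm)
  have hsub : ball (0 : Euc n) (3 * ρ / 2) ⊆ ball 0 1 := ball_subset_ball (by linarith)
  have hsubR : ball (0 : Euc n) (3 * ρ / 2) ⊆ ball 0 ((3 * ρ / 2 + 1) / 2) :=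
    ball_subset_ball (by linarith)
  have hsubρ : ball (0 : Euc n) ρ ⊆ ball 0 (3 * ρ / 2) := ball_subset_ball (by linarith)
  have hηφ : ∀ x ∈ ball (0 : Euc n) ρ, η x = φ x := fun x hx =>
    (hηg x hx).trans (hgφ (hsub (hsubρ hx))).symm
  have hgη : ∀ x ∈ ball (0 : Euc n) ρ, gradient η x = gradient φ x := fun x hx =>
    Filter.EventuallyEq.gradient_eq (eventually_of_mem (isOpen_ball.mem_nhds hx) hηφ)
  have hgvρ : ∀ x ∈ ball (0 : Euc n) ρ, gradient v x = gradient u x := fun x hx =>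
    hgv x (hsubR (hsubρ hx))
  rw [hv.setIntegral_stabDensity hp hR1 hη] at hle
  have e1 : ∫ x in ball (0 : Euc n) ρ, 2 * ‖gradient u x‖ ^ p * ‖x‖ * radialDeriv φ x * φ x =
      ∫ x in ball (0 : Euc n) ρ, ‖gradient v x‖ ^ p * (2 * (⟪x, gradient η x⟫ * η x)) :=
    setIntegral_congr_fun measurableSet_ball fun x hx => by
      simp only [hgvρ x hx, hgη x hx, hηφ x hx, ← norm_mul_radialDeriv]
      ring
  have e2 : ∫ x in ball (0 : Euc n) ρ, ‖x‖ * radialDeriv u x * ‖gradient u x‖ ^ (p - 2) *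
        ⟪gradient u x, gradient (fun y => φ y ^ 2) x⟫ =
      ∫ x in ball (0 : Euc n) ρ, ⟪x, gradient v x⟫ * ‖gradient v x‖ ^ (p - 2) *
        (2 * (⟪gradient v x, gradient η x⟫ * η x)) := by
    refine setIntegral_congr_ae measurableSet_ball ?_
    filter_upwards [hη.ae_differentiableAt] with x hxd hx
    have h1 : gradient (fun y => φ y ^ 2) x = (2 * η x) • gradient η x := by
      rw [← IsStableModel.gradient_mul_self hxd]
      refine Filter.EventuallyEq.gradient_eq
        (eventually_of_mem (isOpen_ball.mem_nhds hx) fun y hy => ?_)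
      simp only [hηφ y hy, sq]
    rw [h1, hgvρ x hx, norm_mul_radialDeriv, real_inner_smul_right]
    ring
  have e3 : ∫ x in ball (0 : Euc n) ρ, ‖gradient u x‖ ^ p * φ x ^ 2 =
      ∫ x in ball (0 : Euc n) ρ, ‖gradient v x‖ ^ p * η x ^ 2 :=
    setIntegral_congr_fun measurableSet_ball fun x hx => by
      simp only [hgvρ x hx, hηφ x hx]
  have e4 : ∫ x in ball (0 : Euc n) ρ, ‖x‖ ^ 2 * radialDeriv u x ^ 2 *
        ‖gradient u x‖ ^ (p - 2) * ‖gradient φ x‖ ^ 2 =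
      ∫ x in ball (0 : Euc n) ρ, ⟪x, gradient v x⟫ ^ 2 * ‖gradient v x‖ ^ (p - 2) *
        ‖gradient η x‖ ^ 2 :=
    setIntegral_congr_fun measurableSet_ball fun x hx => by
      simp only [hgvρ x hx, hgη x hx, ← norm_mul_radialDeriv, mul_pow]
  have e5 : ∫ x in ball (0 : Euc n) ρ, ‖x‖ ^ 2 * radialDeriv u x ^ 2 *
        ‖gradient u x‖ ^ (p - 4) * ⟪gradient u x, gradient φ x⟫ ^ 2 =
      ∫ x in ball (0 : Euc n) ρ, ⟪x, gradient v x⟫ ^ 2 * ‖gradient v x‖ ^ (p - 4) *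
        ⟪gradient v x, gradient η x⟫ ^ 2 :=
    setIntegral_congr_fun measurableSet_ball fun x hx => by
      simp only [hgvρ x hx, hgη x hx, ← norm_mul_radialDeriv, mul_pow]
  have e6 : ∫ x in ball (0 : Euc n) (3 * ρ / 2) \ ball (0 : Euc n) ρ, ‖gradient u x‖ ^ p *
        (φ x ^ 2 + ‖x‖ * |φ x| * ‖gradient φ x‖ + ‖x‖ ^ 2 * ‖gradient φ x‖ ^ 2) =
      ∫ x in ball (0 : Euc n) (3 * ρ / 2) \ ball (0 : Euc n) ρ,
        ‖gradient v x‖ ^ p * annulusDensity x (gradient g x) (g x) :=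
    setIntegral_congr_fun (measurableSet_ball.diff measurableSet_ball) fun x hx => by
      simp only [annulusDensity, hgv x (hsubR hx.1), hgradg x (hsub hx.1), hgφ (hsub hx.1)]
  rw [e1, e2, e3, e4, e5, e6]
  exact hle
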